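/- arXiv:1708.01832 — 2 statements merged into one kernel-verified Lean document; each statement's English description precedes it below -/
import Mathlib

section
/- Fix σ ∈ (0,1) and let (ζ, ψ) ∈ C_T satisfy I_T(ζ, ψ) < ∞. Then there exists φ* ∈ S_T(ζ, ψ) such that: (a) ∑_{k≥0} ∫_{[0,T]×[0,1]} ℓ(φ*_k(s,y)) ds dy ≤ I_T(ζ, ψ) + σ; and (b) if (ζ̃, ψ̃) is another pair in C_T with φ* ∈ S_T(ζ̃, ψ̃), then (ζ̃, ψ̃) = (ζ, ψ). -/
open MeasureTheory Filter Topology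
open scoped ENNReal

noncomputable def ell (x : ℝ) : ℝ := x * Real.log x - x + 1

noncomputable def rtot (x : ℕ → ℝ) : ℝ := max (x 0) 0 + ∑' k : ℕ, (k : ℝ) * x k

noncomputable def rcoord (x : ℕ → ℝ) (k : ℕ) : ℝ :=
  if 0 < rtot x then (if k = 0 then max (x 0) 0 else (k : ℝ) * x k) / rtot x else 0

noncomputable def skorokhod (ψ : ℝ → ℝ) (t : ℝ) : ℝ :=
  ψ t - min (sInf (ψ '' Set.Icc 0 t)) 0

def AbsCont (f : ℝ → ℝ) (a b : ℝ) : Prop :=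
  ∀ ε > 0, ∃ δ > 0, ∀ n : ℕ, ∀ I : Fin n → ℝ × ℝ,
    (∀ i, (I i).1 ∈ Set.Icc a b ∧ (I i).2 ∈ Set.Icc a b ∧ (I i).1 ≤ (I i).2) →
    (∀ i j, i ≠ j → Disjoint (Set.Ioo (I i).1 (I i).2) (Set.Ioo (I j).1 (I j).2)) →
    (∑ i, ((I i).2 - (I i).1)) < δ →
    (∑ i, |f (I i).2 - f (I i).1|) < ε

def memCT (T : ℝ) (p : ℕ → ℝ) (ζ : ℕ → ℝ → ℝ) (ψ : ℝ → ℝ) : Prop :=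
  (∀ k, ContinuousOn (ζ k) (Set.Icc 0 T)) ∧
  ContinuousOn ψ (Set.Icc 0 T) ∧
  ψ 0 = 0 ∧ AbsCont ψ 0 T ∧
  (∀ t ∈ Set.Icc (0:ℝ) T, ζ 0 t = skorokhod ψ t) ∧
  (∀ k : ℕ, 1 ≤ k →
    ζ k 0 = p k ∧ (∀ t ∈ Set.Icc (0:ℝ) T, 0 ≤ ζ k t) ∧
    AntitoneOn (ζ k) (Set.Icc 0 T) ∧ AbsCont (ζ k) 0 T)

noncomputable def Bint (ζ : ℕ → ℝ → ℝ) (φ : ℕ → ℝ → ℝ → ℝ) (k : ℕ) (t : ℝ) : ℝ :=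
  ∫ q in (Set.Icc (0:ℝ) t) ×ˢ (Set.Icc (0:ℝ) 1),
    (if 0 ≤ q.2 ∧ q.2 < rcoord (fun j => ζ j q.1) k then φ k q.1 q.2 else 0)

def memST (T : ℝ) (p : ℕ → ℝ) (ζ : ℕ → ℝ → ℝ) (ψ : ℝ → ℝ) (φ : ℕ → ℝ → ℝ → ℝ) : Prop :=
  (∀ k, Measurable (fun q : ℝ × ℝ => φ k q.1 q.2)) ∧
  (∀ k s y, 0 ≤ φ k s y) ∧
  (∀ k, IntegrableOn
      (fun q : ℝ × ℝ => if 0 ≤ q.2 ∧ q.2 < rcoord (fun j => ζ j q.1) k then φ k q.1 q.2 else 0)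
      ((Set.Icc (0:ℝ) T) ×ˢ (Set.Icc (0:ℝ) 1))) ∧
  (∀ t ∈ Set.Icc (0:ℝ) T, ψ t = ∑' k : ℕ, ((k : ℝ) - 2) * Bint ζ φ k t) ∧
  (∀ t ∈ Set.Icc (0:ℝ) T, ∀ k : ℕ, 1 ≤ k → ζ k t = p k - Bint ζ φ k t)

noncomputable def costE (T : ℝ) (φ : ℕ → ℝ → ℝ → ℝ) : ℝ≥0∞ :=
  ∑' k : ℕ, ∫⁻ q in (Set.Icc (0:ℝ) T) ×ˢ (Set.Icc (0:ℝ) 1),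
    ENNReal.ofReal (ell (φ k q.1 q.2))

open Classical in
noncomputable def rateI (T : ℝ) (p : ℕ → ℝ) (ζ : ℕ → ℝ → ℝ) (ψ : ℝ → ℝ) : ℝ≥0∞ :=
  if memCT T p ζ ψ then ⨅ (φ : ℕ → ℝ → ℝ → ℝ) (_ : memST T p ζ ψ φ), costE T φ else ⊤

theorem skorokhod_nonneg {T : ℝ} {ψ : ℝ → ℝ} (hψ : ContinuousOn ψ (Set.Icc 0 T)) {t : ℝ}
    (ht : t ∈ Set.Icc 0 T) : 0 ≤ skorokhod ψ t := by
  have hc : ContinuousOn ψ (Set.Icc 0 t) := hψ.mono (Set.Icc_subset_Icc_right ht.2)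
  have h := csInf_le (isCompact_Icc.image_of_continuousOn hc).bddBelow
    (Set.mem_image_of_mem ψ (Set.right_mem_Icc.2 ht.1))
  unfold skorokhod
  linarith [min_le_left (sInf (ψ '' Set.Icc 0 t)) 0]

/-- The reflection term of the Skorokhod map is nondecreasing. -/
theorem sub_le_skorokhod_sub {T : ℝ} {ψ : ℝ → ℝ} (hψ : ContinuousOn ψ (Set.Icc 0 T)) {s t : ℝ}
    (hs : 0 ≤ s) (hst : s ≤ t) (ht : t ≤ T) :
    ψ t - ψ s ≤ skorokhod ψ t - skorokhod ψ s := by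
  have hc : ContinuousOn ψ (Set.Icc 0 t) := hψ.mono (Set.Icc_subset_Icc_right ht)
  have h : sInf (ψ '' Set.Icc 0 t) ≤ sInf (ψ '' Set.Icc 0 s) :=
    csInf_le_csInf (isCompact_Icc.image_of_continuousOn hc).bddBelow
      ((Set.nonempty_Icc.2 hs).image ψ) (Set.image_mono (Set.Icc_subset_Icc_right hst))
  unfold skorokhod
  linarith [min_le_min_right 0 h]

/-- The reflection term of the Skorokhod map does not increase while the reflected path is
positive. -/
theorem skorokhod_sub_le {T : ℝ} {ψ : ℝ → ℝ} (hψ : ContinuousOn ψ (Set.Icc 0 T)) {s t : ℝ}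
    (hs : 0 ≤ s) (hst : s ≤ t) (ht : t ≤ T) (hpos : ∀ v ∈ Set.Ioc s t, 0 < skorokhod ψ v) :
    skorokhod ψ t - skorokhod ψ s ≤ ψ t - ψ s := by
  have hc : ContinuousOn ψ (Set.Icc 0 t) := hψ.mono (Set.Icc_subset_Icc_right ht)
  have hbd := (isCompact_Icc.image_of_continuousOn hc).bddBelow
  obtain ⟨u, hu, hinf⟩ :=
    isCompact_Icc.exists_sInf_image_eq (Set.nonempty_Icc.2 (hs.trans hst)) hc
  have key : min (sInf (ψ '' Set.Icc 0 s)) 0 ≤ min (sInf (ψ '' Set.Icc 0 t)) 0 := by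
    rcases le_or_gt u s with hus | hus
    · refine min_le_min_right 0 (hinf ▸ csInf_le ?_ (Set.mem_image_of_mem ψ ⟨hu.1, hus⟩))
      exact hbd.mono (Set.image_mono (Set.Icc_subset_Icc_right hst))
    · have hp := hpos u ⟨hus, hu.2⟩
      have hle : ψ u ≤ sInf (ψ '' Set.Icc 0 u) :=
        hinf ▸ csInf_le_csInf hbd ((Set.nonempty_Icc.2 hu.1).image ψ)
          (Set.image_mono (Set.Icc_subset_Icc_right hu.2))
      unfold skorokhod at hp
      have hu0 : 0 < ψ u := by
        by_contra! h0
        linarith [le_min hle h0]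
      rw [hinf, min_eq_right hu0.le]
      exact min_le_right _ _
  unfold skorokhod
  linarith

/-- A continuous function which cannot grow faster than `g` while above `g`, and which starts
below `g`, stays below `g`. -/
theorem le_of_sub_le_sub_while_above {f g : ℝ → ℝ} {a b : ℝ} (hf : ContinuousOn f (Set.Icc a b))
    (hg : ContinuousOn g (Set.Icc a b)) (ha : f a ≤ g a)
    (h : ∀ s t, a ≤ s → s ≤ t → t ≤ b → (∀ v ∈ Set.Ioc s t, g v < f v) → f t - f s ≤ g t - g s) :
    ∀ t ∈ Set.Icc a b, f t ≤ g t := by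
  intro t ht
  by_contra! hlt
  have hsub : Set.Icc a t ⊆ Set.Icc a b := Set.Icc_subset_Icc_right ht.2
  have hclosed : IsClosed {v ∈ Set.Icc a t | f v ≤ g v} :=
    isClosed_Icc.isClosed_le (hf.mono hsub) (hg.mono hsub)
  have hcomp : IsCompact {v ∈ Set.Icc a t | f v ≤ g v} :=
    isCompact_Icc.of_isClosed_subset hclosed fun v hv => hv.1
  obtain ⟨s, hs, hmax⟩ := hcomp.exists_isGreatest ⟨a, ⟨le_rfl, ht.1⟩, ha⟩
  have := h s t hs.1.1 hs.1.2 ht.2 fun v hv => by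
    by_contra! hv'
    exact absurd (hmax ⟨⟨hs.1.1.trans hv.1.le, hv.2⟩, hv'⟩) (not_le.2 hv.1)
  linarith [hs.2]

section Masses

variable {T : ℝ} {p : ℕ → ℝ} {ζ : ℕ → ℝ → ℝ} {ψ : ℝ → ℝ} {φ : ℕ → ℝ → ℝ → ℝ}

theorem memCT.coord_nonneg (h : memCT T p ζ ψ) {t : ℝ} (ht : t ∈ Set.Icc 0 T) (k : ℕ) :
    0 ≤ ζ k t := by
  rcases Nat.eq_zero_or_pos k with rfl | hk
  · rw [h.2.2.2.2.1 t ht]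
    exact skorokhod_nonneg h.2.1 ht
  · exact (h.2.2.2.2.2 k hk).2.1 t ht

theorem memCT.natCast_mul_le (h : memCT T p ζ ψ) {t : ℝ} (ht : t ∈ Set.Icc 0 T) (k : ℕ) :
    (k : ℝ) * ζ k t ≤ k * p k := by
  rcases Nat.eq_zero_or_pos k with rfl | hk
  · simp
  · obtain ⟨h0, -, hanti, -⟩ := h.2.2.2.2.2 k hk
    rw [← h0]
    exact mul_le_mul_of_nonneg_left (hanti ⟨le_rfl, ht.1.trans ht.2⟩ ht ht.1) k.cast_nonneg

theorem memCT.summable (h : memCT T p ζ ψ) (hμ : Summable fun k : ℕ => (k : ℝ) * p k)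
    {t : ℝ} (ht : t ∈ Set.Icc 0 T) : Summable fun k : ℕ => (k : ℝ) * ζ k t :=
  hμ.of_nonneg_of_le (fun k => mul_nonneg k.cast_nonneg (h.coord_nonneg ht k))
    (h.natCast_mul_le ht)

theorem memCT.continuousOn_rtot (h : memCT T p ζ ψ) (hμ : Summable fun k : ℕ => (k : ℝ) * p k) :
    ContinuousOn (fun t => rtot fun j => ζ j t) (Set.Icc 0 T) := by
  unfold rtot
  refine ((h.1 0).sup continuousOn_const).add (continuousOn_tsum
    (fun k => continuousOn_const.mul (h.1 k)) hμ fun k t ht => ?_)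
  rw [Real.norm_of_nonneg (mul_nonneg k.cast_nonneg (h.coord_nonneg ht k))]
  exact h.natCast_mul_le ht k

theorem memCT.rtot_nonneg (h : memCT T p ζ ψ) {t : ℝ} (ht : t ∈ Set.Icc 0 T) :
    0 ≤ rtot fun j => ζ j t :=
  add_nonneg (le_max_right _ _)
    (tsum_nonneg fun k => mul_nonneg k.cast_nonneg (h.coord_nonneg ht k))

theorem memCT.rcoord_of_pos (h : memCT T p ζ ψ) {t : ℝ} (ht : t ∈ Set.Icc 0 T)
    (hr : 0 < rtot fun j => ζ j t) (k : ℕ) :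
    rcoord (fun j => ζ j t) k =
      (if k = 0 then 1 else (k : ℝ)) * ζ k t / rtot fun j => ζ j t := by
  unfold rcoord
  rw [if_pos hr]
  rcases eq_or_ne k 0 with rfl | hk
  · simp [max_eq_left (h.coord_nonneg ht 0)]
  · simp [hk]

theorem memCT.rcoord_nonneg (h : memCT T p ζ ψ) {t : ℝ} (ht : t ∈ Set.Icc 0 T) (k : ℕ) :
    0 ≤ rcoord (fun j => ζ j t) k := by
  by_cases hr : 0 < rtot fun j => ζ j t
  · rw [h.rcoord_of_pos ht hr]
    have := h.coord_nonneg ht k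
    split_ifs <;> positivity
  · simp [rcoord, hr]

theorem memCT.tsum_rcoord_le (h : memCT T p ζ ψ) (hμ : Summable fun k : ℕ => (k : ℝ) * p k)
    {t : ℝ} (ht : t ∈ Set.Icc 0 T) :
    ∑' k : ℕ, ENNReal.ofReal (rcoord (fun j => ζ j t) k) ≤ 1 := by
  by_cases hr : 0 < rtot fun j => ζ j t
  · have hs := h.summable hμ ht
    have hsum : HasSum (fun k : ℕ => rcoord (fun j => ζ j t) k) 1 := by
      have h1 : HasSum (fun k : ℕ => (if k = 0 then max (ζ 0 t) 0 else 0) + (k : ℝ) * ζ k t)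
          (rtot fun j => ζ j t) := (hasSum_ite_eq 0 (max (ζ 0 t) 0)).add hs.hasSum
      have h2 := h1.div_const (rtot fun j => ζ j t)
      rw [div_self hr.ne'] at h2
      refine (funext fun k => ?_ : (fun k : ℕ => rcoord (fun j => ζ j t) k) = _) ▸ h2
      rcases eq_or_ne k 0 with rfl | hk
      · simp [rcoord, hr]
      · simp [rcoord, hr, hk]
    rw [← ENNReal.ofReal_tsum_of_nonneg (h.rcoord_nonneg ht) hsum.summable, hsum.tsum_eq]
    simp
  · simp [rcoord, hr]

theorem memCT.rcoord_le_one (h : memCT T p ζ ψ) (hμ : Summable fun k : ℕ => (k : ℝ) * p k)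
    {t : ℝ} (ht : t ∈ Set.Icc 0 T) (k : ℕ) : rcoord (fun j => ζ j t) k ≤ 1 :=
  ENNReal.ofReal_le_one.1 ((ENNReal.le_tsum k).trans (h.tsum_rcoord_le hμ ht))

theorem memCT.start (h : memCT T p ζ ψ) (hT : 0 ≤ T) (k : ℕ) :
    ζ k 0 = if k = 0 then 0 else p k := by
  rcases Nat.eq_zero_or_pos k with rfl | hk
  · rw [h.2.2.2.2.1 0 ⟨le_rfl, hT⟩]
    simp [skorokhod, h.2.2.1]
  · rw [(h.2.2.2.2.2 k hk).1, if_neg hk.ne']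

end Masses
/-- The part of the control `φ k` lying below the threshold `rcoord ζ k`. -/
noncomputable def consumed (ζ : ℕ → ℝ → ℝ) (φ : ℕ → ℝ → ℝ → ℝ) (k : ℕ) (q : ℝ × ℝ) : ℝ :=
  if 0 ≤ q.2 ∧ q.2 < rcoord (fun j => ζ j q.1) k then φ k q.1 q.2 else 0

theorem consumed_nonneg {ζ : ℕ → ℝ → ℝ} {φ : ℕ → ℝ → ℝ → ℝ} (hφ : ∀ k s y, 0 ≤ φ k s y) (k : ℕ)
    (q : ℝ × ℝ) : 0 ≤ consumed ζ φ k q := by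
  unfold consumed
  split_ifs
  exacts [hφ _ _ _, le_rfl]

theorem Bint_eq (ζ : ℕ → ℝ → ℝ) (φ : ℕ → ℝ → ℝ → ℝ) (k : ℕ) (t : ℝ) :
    Bint ζ φ k t = ∫ q in Set.Icc 0 t ×ˢ Set.Icc 0 1, consumed ζ φ k q := rfl

section Increments

variable {T : ℝ} {p : ℕ → ℝ} {ζ ζ' : ℕ → ℝ → ℝ} {ψ ψ' : ℝ → ℝ} {φ : ℕ → ℝ → ℝ → ℝ}

theorem memST.integrableOn (h : memST T p ζ ψ φ) (k : ℕ) :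
    IntegrableOn (consumed ζ φ k) (Set.Icc 0 T ×ˢ Set.Icc 0 1) := h.2.2.1 k

theorem memST.Bint_sub (h : memST T p ζ ψ φ) (k : ℕ) {s t : ℝ} (hst : s ≤ t) (ht : t ≤ T) :
    Bint ζ φ k t - Bint ζ φ k s =
      ∫ q in Set.Icc 0 t ×ˢ Set.Icc 0 1 \ Set.Icc 0 s ×ˢ Set.Icc 0 1, consumed ζ φ k q :=
  (setIntegral_sdiff (measurableSet_Icc.prod measurableSet_Icc)
    ((h.integrableOn k).mono_set (Set.prod_mono_left (Set.Icc_subset_Icc_right ht)))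
    (Set.prod_mono_left (Set.Icc_subset_Icc_right hst))).symm

theorem memST.Bint_mono (h : memST T p ζ ψ φ) (k : ℕ) {s t : ℝ} (hst : s ≤ t) (ht : t ≤ T) :
    Bint ζ φ k s ≤ Bint ζ φ k t := by
  rw [← sub_nonneg, h.Bint_sub k hst ht]
  exact integral_nonneg fun q => consumed_nonneg h.2.1 k q

theorem memST.Bint_sub_le (h : memST T p ζ ψ φ) (h' : memST T p ζ' ψ' φ) (k : ℕ) {s t : ℝ}
    (hst : s ≤ t) (ht : t ≤ T)
    (hle : ∀ v ∈ Set.Ioc s t, ∀ y, consumed ζ φ k (v, y) ≤ consumed ζ' φ k (v, y)) :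
    Bint ζ φ k t - Bint ζ φ k s ≤ Bint ζ' φ k t - Bint ζ' φ k s := by
  rw [h.Bint_sub k hst ht, h'.Bint_sub k hst ht]
  have hsub : Set.Icc 0 t ×ˢ Set.Icc (0 : ℝ) 1 \ Set.Icc 0 s ×ˢ Set.Icc 0 1 ⊆
      Set.Icc 0 T ×ˢ Set.Icc 0 1 :=
    Set.sdiff_subset.trans (Set.prod_mono_left (Set.Icc_subset_Icc_right ht))
  have hm := measurableSet_Icc (a := (0 : ℝ)) (b := 1)
  refine setIntegral_mono_on ((h.integrableOn k).mono_set hsub) ((h'.integrableOn k).mono_set hsub)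
    ((measurableSet_Icc.prod hm).diff (measurableSet_Icc.prod hm)) ?_
  rintro ⟨v, y⟩ ⟨⟨hv, hy⟩, hn⟩
  refine hle v ⟨?_, hv.2⟩ y
  by_contra! hvs
  exact hn ⟨⟨hv.1, hvs⟩, hy⟩

theorem memST.summable_drift (h : memST T p ζ ψ φ) (hCT : memCT T p ζ ψ)
    (hp : Summable p) (hμ : Summable fun k : ℕ => (k : ℝ) * p k) {t : ℝ}
    (ht : t ∈ Set.Icc 0 T) : Summable fun k : ℕ => ((k : ℝ) - 2) * Bint ζ φ k t := by
  rw [← summable_nat_add_iff 1]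
  have hb : Summable fun k : ℕ => (k : ℝ) * p k + 2 * p k := hμ.add (hp.mul_left 2)
  refine Summable.of_norm_bounded ((summable_nat_add_iff 1).2 hb) fun k => ?_
  obtain ⟨h0, hnn, hanti, -⟩ := hCT.2.2.2.2.2 (k + 1) k.succ_pos
  have h1 := h.2.2.2.2 t ht (k + 1) k.succ_pos
  have h2 := hnn t ht
  have h3 := hanti ⟨le_rfl, ht.1.trans ht.2⟩ ht ht.1
  rw [h0] at h3
  have hB0 : 0 ≤ Bint ζ φ (k + 1) t := by linarith
  have hB1 : Bint ζ φ (k + 1) t ≤ p (k + 1) := by linarith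
  rw [norm_mul, Real.norm_of_nonneg hB0, ← add_mul]
  have : ‖((k + 1 : ℕ) : ℝ) - 2‖ ≤ ((k + 1 : ℕ) : ℝ) + 2 := by
    rw [Real.norm_eq_abs, abs_le]
    constructor <;> linarith [(k + 1).cast_nonneg (α := ℝ)]
  gcongr

/-- When the masses with positive index coincide, the paths differ only through the index `0`
consumption. -/
theorem memST.drift_sub (h : memST T p ζ ψ φ) (h' : memST T p ζ' ψ' φ) (hCT : memCT T p ζ ψ)
    (hCT' : memCT T p ζ' ψ') (hp : Summable p)
    (hμ : Summable fun k : ℕ => (k : ℝ) * p k) {t t' : ℝ} (ht : t ∈ Set.Icc 0 T)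
    (ht' : t' ∈ Set.Icc 0 T) (heq : ∀ k, 1 ≤ k → ζ' k t' = ζ k t) :
    ψ' t' - ψ t = -2 * (Bint ζ' φ 0 t' - Bint ζ φ 0 t) := by
  rw [h.2.2.2.1 t ht, h'.2.2.2.1 t' ht', ← (h'.summable_drift hCT' hp hμ ht').tsum_sub
    (h.summable_drift hCT hp hμ ht), tsum_eq_single 0]
  · push_cast
    ring
  · intro k hk
    have hk' := Nat.one_le_iff_ne_zero.2 hk
    have h1 := h.2.2.2.2 t ht k hk'
    have h2 := h'.2.2.2.2 t' ht' k hk'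
    have h3 := heq k hk'
    rw [show Bint ζ' φ k t' = Bint ζ φ k t by linarith, sub_self]

end Increments

section Uniqueness

variable {T : ℝ} {p : ℕ → ℝ} {ζ ζ' : ℕ → ℝ → ℝ} {ψ ψ' : ℝ → ℝ} {φ : ℕ → ℝ → ℝ → ℝ}

/-- Once the total mass has vanished, every mass remains zero. -/
theorem memST.eq_zero_of_rtot_eq_zero (h : memST T p ζ ψ φ) (hCT : memCT T p ζ ψ)
    (hp : Summable p) (hμ : Summable fun k : ℕ => (k : ℝ) * p k) {x : ℝ}
    (hx : x ∈ Set.Icc 0 T) (hr : rtot (fun j => ζ j x) = 0) (k : ℕ) :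
    ∀ t ∈ Set.Icc x T, ζ k t = 0 := by
  have hnn : ∀ j : ℕ, 0 ≤ (j : ℝ) * ζ j x := fun j =>
    mul_nonneg j.cast_nonneg (hCT.coord_nonneg hx j)
  have hsum : (∑' j : ℕ, (j : ℝ) * ζ j x) = 0 := by
    unfold rtot at hr
    linarith [le_max_right (ζ 0 x) 0, (tsum_nonneg hnn : 0 ≤ ∑' j : ℕ, (j : ℝ) * ζ j x)]
  have h0 : ζ 0 x ≤ 0 := by
    unfold rtot at hr
    rw [hsum] at hr
    linarith [le_max_left (ζ 0 x) 0]
  have hsub : Set.Icc x T ⊆ Set.Icc 0 T := Set.Icc_subset_Icc_left hx.1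
  have hpos : ∀ j, 1 ≤ j → ∀ t ∈ Set.Icc x T, ζ j t = 0 := by
    intro j hj t ht
    have hjx : (j : ℝ) * ζ j x = 0 :=
      congrFun ((hasSum_zero_iff_of_nonneg hnn).1 (hsum ▸ (hCT.summable hμ hx).hasSum)) j
    have hjx' : ζ j x = 0 := by
      rcases mul_eq_zero.1 hjx with hj0 | hj0
      · exact absurd (Nat.cast_eq_zero.1 hj0) (by omega)
      · exact hj0
    refine le_antisymm ?_ (hCT.coord_nonneg (hsub ht) j)
    rw [← hjx']
    exact (hCT.2.2.2.2.2 j hj).2.2.1 hx (hsub ht) ht.1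
  rcases Nat.eq_zero_or_pos k with rfl | hk
  · intro t ht
    refine le_antisymm ?_ (hCT.coord_nonneg (hsub ht) 0)
    refine le_of_sub_le_sub_while_above (g := fun _ => 0) ((hCT.1 0).mono hsub) continuousOn_const h0
      (fun s t hs hst ht hv => ?_) t ht
    have hs' : s ∈ Set.Icc 0 T := hsub ⟨hs, hst.trans ht⟩
    have ht' : t ∈ Set.Icc 0 T := hsub ⟨hs.trans hst, ht⟩
    have hdrift := h.drift_sub h hCT hCT hp hμ hs' ht' fun j hj => by
      rw [hpos j hj t ⟨hs.trans hst, ht⟩, hpos j hj s ⟨hs, hst.trans ht⟩]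
    have hΓ := skorokhod_sub_le hCT.2.1 hs'.1 hst ht fun v hv' => by
      rw [← hCT.2.2.2.2.1 v ⟨hs'.1.trans hv'.1.le, hv'.2.trans ht⟩]
      exact hv v hv'
    rw [hCT.2.2.2.2.1 t ht', hCT.2.2.2.2.1 s hs']
    linarith [h.Bint_mono 0 hst ht]
  · exact hpos k hk

/-- The control `φ` vanishes in the window `[(1 - ε) r, (1 + ε) r)` around the thresholds `r` of
`ζ`. -/
def HasGap (T ε : ℝ) (ζ : ℕ → ℝ → ℝ) (φ : ℕ → ℝ → ℝ → ℝ) : Prop :=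
  ∀ k, ∀ s ∈ Set.Icc 0 T, ∀ y, (1 - ε) * rcoord (fun j => ζ j s) k ≤ y →
    y < (1 + ε) * rcoord (fun j => ζ j s) k → φ k s y = 0

theorem HasGap.consumed_le {ε : ℝ} (hgap : HasGap T ε ζ φ) (hφ : ∀ k s y, 0 ≤ φ k s y)
    (hCT : memCT T p ζ ψ) {k : ℕ} {s : ℝ} (hs : s ∈ Set.Icc 0 T)
    (hle : (1 - ε) * rcoord (fun j => ζ j s) k ≤ rcoord (fun j => ζ' j s) k) (y : ℝ) :
    consumed ζ φ k (s, y) ≤ consumed ζ' φ k (s, y) := by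
  have hr := hCT.rcoord_nonneg hs k
  by_cases hy : 0 ≤ y ∧ y < rcoord (fun j => ζ j s) k
  · rcases lt_or_ge y ((1 - ε) * rcoord (fun j => ζ j s) k) with h1 | h1
    · simp only [consumed]
      rw [if_pos hy, if_pos ⟨hy.1, h1.trans_le hle⟩]
    · have : φ k s y = 0 := hgap k s hs y h1 (by nlinarith)
      simp [consumed, this]
  · simp only [consumed]
    rw [if_neg hy]
    exact consumed_nonneg (ζ := ζ') hφ k (s, y)

theorem HasGap.le_consumed {ε : ℝ} (hgap : HasGap T ε ζ φ) (hφ : ∀ k s y, 0 ≤ φ k s y)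
    (hCT : memCT T p ζ ψ) {k : ℕ} {s : ℝ} (hs : s ∈ Set.Icc 0 T)
    (hle : rcoord (fun j => ζ' j s) k ≤ (1 + ε) * rcoord (fun j => ζ j s) k) (y : ℝ) :
    consumed ζ' φ k (s, y) ≤ consumed ζ φ k (s, y) := by
  have hr := hCT.rcoord_nonneg hs k
  by_cases hy : 0 ≤ y ∧ y < rcoord (fun j => ζ' j s) k
  · rcases lt_or_ge y (rcoord (fun j => ζ j s) k) with h1 | h1
    · simp only [consumed]
      rw [if_pos hy, if_pos ⟨hy.1, h1⟩]
    · have : φ k s y = 0 := hgap k s hs y (by nlinarith) (hy.2.trans_le hle)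
      simp [consumed, this]
  · simp only [consumed]
    rw [if_neg hy]
    exact consumed_nonneg (ζ := ζ) hφ k (s, y)

/-- Two solutions driven by a control with a gap, which agree at `x` and whose total masses have
ratio close to one after `x`, agree after `x`. -/
theorem HasGap.eqOn_Icc {ε : ℝ} (hgap : HasGap T ε ζ φ) (hε1 : ε ≤ 1)
    (h : memST T p ζ ψ φ) (h' : memST T p ζ' ψ' φ) (hCT : memCT T p ζ ψ)
    (hCT' : memCT T p ζ' ψ') (hp : Summable p)
    (hμ : Summable fun k : ℕ => (k : ℝ) * p k) {x u : ℝ} (hx : 0 ≤ x) (hu : u ≤ T)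
    (hxeq : ∀ k, ζ' k x = ζ k x)
    (hr : ∀ v ∈ Set.Icc x u, 0 < rtot (fun j => ζ j v) ∧ 0 < rtot (fun j => ζ' j v) ∧
      (1 - ε) * rtot (fun j => ζ' j v) ≤ rtot (fun j => ζ j v) ∧
      rtot (fun j => ζ j v) ≤ (1 + ε) * rtot (fun j => ζ' j v)) (k : ℕ) :
    ∀ t ∈ Set.Icc x u, ζ' k t = ζ k t := by
  have hsub : Set.Icc x u ⊆ Set.Icc 0 T := Set.Icc_subset_Icc hx hu
  have hup : ∀ k, ∀ v ∈ Set.Icc x u, ζ k v ≤ ζ' k v → ∀ y,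
      consumed ζ φ k (v, y) ≤ consumed ζ' φ k (v, y) := by
    intro k v hv hle
    obtain ⟨h1, h2, h3, h4⟩ := hr v hv
    refine hgap.consumed_le h.2.1 hCT (hsub hv) ?_
    rw [hCT.rcoord_of_pos (hsub hv) h1, hCT'.rcoord_of_pos (hsub hv) h2, ← mul_div_assoc,
      div_le_div_iff₀ h1 h2]
    have hm : (0 : ℝ) ≤ if k = 0 then 1 else (k : ℝ) := by split_ifs <;> positivity
    have ha := hCT.coord_nonneg (hsub hv) k
    have hA : (if k = 0 then 1 else (k : ℝ)) * ζ k v ≤ (if k = 0 then 1 else (k : ℝ)) * ζ' k v :=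
      mul_le_mul_of_nonneg_left hle hm
    calc _ = (if k = 0 then 1 else (k : ℝ)) * ζ k v * ((1 - ε) * rtot fun j => ζ' j v) := by ring
      _ ≤ _ := mul_le_mul hA h3 (mul_nonneg (by linarith) h2.le) ((mul_nonneg hm ha).trans hA)
  have hdown : ∀ k, ∀ v ∈ Set.Icc x u, ζ' k v ≤ ζ k v → ∀ y,
      consumed ζ' φ k (v, y) ≤ consumed ζ φ k (v, y) := by
    intro k v hv hle
    obtain ⟨h1, h2, h3, h4⟩ := hr v hv
    refine hgap.le_consumed h.2.1 hCT (hsub hv) ?_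
    rw [hCT.rcoord_of_pos (hsub hv) h1, hCT'.rcoord_of_pos (hsub hv) h2, ← mul_div_assoc,
      div_le_div_iff₀ h2 h1]
    have hm : (0 : ℝ) ≤ if k = 0 then 1 else (k : ℝ) := by split_ifs <;> positivity
    have ha := hCT'.coord_nonneg (hsub hv) k
    have hA : (if k = 0 then 1 else (k : ℝ)) * ζ' k v ≤ (if k = 0 then 1 else (k : ℝ)) * ζ k v :=
      mul_le_mul_of_nonneg_left hle hm
    calc _ ≤ (if k = 0 then 1 else (k : ℝ)) * ζ k v * ((1 + ε) * rtot fun j => ζ' j v) :=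
          mul_le_mul hA h4 h1.le ((mul_nonneg hm ha).trans hA)
      _ = _ := by ring
  have hkpos : ∀ k, 1 ≤ k → ∀ t ∈ Set.Icc x u, ζ' k t = ζ k t := by
    intro k hk t ht
    apply le_antisymm
    · refine le_of_sub_le_sub_while_above ((hCT'.1 k).mono hsub) ((hCT.1 k).mono hsub)
        (hxeq k).le (fun s t hs hst ht hv => ?_) t ht
      have hs' : s ∈ Set.Icc 0 T := hsub ⟨hs, hst.trans ht⟩
      have ht' : t ∈ Set.Icc 0 T := hsub ⟨hs.trans hst, ht⟩
      have := h.Bint_sub_le h' k hst ht'.2 fun v hv' =>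
        hup k v ⟨hs.trans hv'.1.le, hv'.2.trans ht⟩ (hv v hv').le
      linarith [h.2.2.2.2 t ht' k hk, h.2.2.2.2 s hs' k hk, h'.2.2.2.2 t ht' k hk,
        h'.2.2.2.2 s hs' k hk]
    · refine le_of_sub_le_sub_while_above ((hCT.1 k).mono hsub) ((hCT'.1 k).mono hsub)
        (hxeq k).ge (fun s t hs hst ht hv => ?_) t ht
      have hs' : s ∈ Set.Icc 0 T := hsub ⟨hs, hst.trans ht⟩
      have ht' : t ∈ Set.Icc 0 T := hsub ⟨hs.trans hst, ht⟩
      have := h'.Bint_sub_le h k hst ht'.2 fun v hv' =>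
        hdown k v ⟨hs.trans hv'.1.le, hv'.2.trans ht⟩ (hv v hv').le
      linarith [h.2.2.2.2 t ht' k hk, h.2.2.2.2 s hs' k hk, h'.2.2.2.2 t ht' k hk,
        h'.2.2.2.2 s hs' k hk]
  rcases Nat.eq_zero_or_pos k with rfl | hk
  swap
  · exact hkpos k hk
  have hdrift : ∀ t ∈ Set.Icc x u, ψ' t - ψ t = -2 * (Bint ζ' φ 0 t - Bint ζ φ 0 t) :=
    fun t ht => h.drift_sub h' hCT hCT' hp hμ (hsub ht) (hsub ht) fun k hk => hkpos k hk t ht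
  intro t ht
  apply le_antisymm
  · refine le_of_sub_le_sub_while_above ((hCT'.1 0).mono hsub) ((hCT.1 0).mono hsub)
      (hxeq 0).le (fun s t hs hst ht hv => ?_) t ht
    have hs' : s ∈ Set.Icc 0 T := hsub ⟨hs, hst.trans ht⟩
    have ht' : t ∈ Set.Icc 0 T := hsub ⟨hs.trans hst, ht⟩
    have hB := h.Bint_sub_le h' 0 hst ht'.2 fun v hv' =>
      hup 0 v ⟨hs.trans hv'.1.le, hv'.2.trans ht⟩ (hv v hv').le
    have hΓ := skorokhod_sub_le hCT'.2.1 hs'.1 hst ht'.2 fun v hv' => by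
      have hvT := hsub ⟨hs.trans hv'.1.le, hv'.2.trans ht⟩
      rw [← hCT'.2.2.2.2.1 v hvT]
      exact (hCT.coord_nonneg hvT 0).trans_lt (hv v hv')
    have hΓ' := sub_le_skorokhod_sub hCT.2.1 hs'.1 hst ht'.2
    rw [hCT.2.2.2.2.1 t ht', hCT.2.2.2.2.1 s hs', hCT'.2.2.2.2.1 t ht', hCT'.2.2.2.2.1 s hs']
    linarith [hdrift s ⟨hs, hst.trans ht⟩, hdrift t ⟨hs.trans hst, ht⟩]
  · refine le_of_sub_le_sub_while_above ((hCT.1 0).mono hsub) ((hCT'.1 0).mono hsub)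
      (hxeq 0).ge (fun s t hs hst ht hv => ?_) t ht
    have hs' : s ∈ Set.Icc 0 T := hsub ⟨hs, hst.trans ht⟩
    have ht' : t ∈ Set.Icc 0 T := hsub ⟨hs.trans hst, ht⟩
    have hB := h'.Bint_sub_le h 0 hst ht'.2 fun v hv' =>
      hdown 0 v ⟨hs.trans hv'.1.le, hv'.2.trans ht⟩ (hv v hv').le
    have hΓ := skorokhod_sub_le hCT.2.1 hs'.1 hst ht'.2 fun v hv' => by
      have hvT := hsub ⟨hs.trans hv'.1.le, hv'.2.trans ht⟩
      rw [← hCT.2.2.2.2.1 v hvT]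
      exact (hCT'.coord_nonneg hvT 0).trans_lt (hv v hv')
    have hΓ' := sub_le_skorokhod_sub hCT'.2.1 hs'.1 hst ht'.2
    rw [hCT.2.2.2.2.1 t ht', hCT.2.2.2.2.1 s hs', hCT'.2.2.2.2.1 t ht', hCT'.2.2.2.2.1 s hs']
    linarith [hdrift s ⟨hs, hst.trans ht⟩, hdrift t ⟨hs.trans hst, ht⟩]

/-- A control with a gap around the thresholds of one of its solutions has no other solution. -/
theorem HasGap.unique {ε : ℝ} (hgap : HasGap T ε ζ φ) (hε : 0 < ε) (hε1 : ε ≤ 1) (hT : 0 ≤ T)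
    (h : memST T p ζ ψ φ) (h' : memST T p ζ' ψ' φ) (hCT : memCT T p ζ ψ)
    (hCT' : memCT T p ζ' ψ') (hp : Summable p)
    (hμ : Summable fun k : ℕ => (k : ℝ) * p k) :
    (∀ k, ∀ t ∈ Set.Icc 0 T, ζ' k t = ζ k t) ∧ ∀ t ∈ Set.Icc 0 T, ψ' t = ψ t := by
  have hζ : Set.Icc 0 T ⊆ {t | ∀ k, ζ' k t = ζ k t} := by
    refine IsClosed.Icc_subset_of_forall_exists_gt ?_ ?_ ?_
    · have : {t | ∀ k, ζ' k t = ζ k t} ∩ Set.Icc 0 T =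
          ⋂ k, {t ∈ Set.Icc 0 T | ζ' k t = ζ k t} := by
        ext t
        simp only [Set.mem_inter_iff, Set.mem_ofPred_eq, Set.mem_iInter]
        exact ⟨fun ht k => ⟨ht.2, ht.1 k⟩, fun ht => ⟨fun k => (ht k).2, (ht 0).1⟩⟩
      rw [this]
      refine isClosed_iInter fun k => ?_
      have hc := ((hCT'.1 k).sub (hCT.1 k)).preimage_isClosed_of_isClosed isClosed_Icc
        (isClosed_singleton (x := 0))
      convert hc using 1
      ext t
      simp [sub_eq_zero]
    · intro k
      rw [hCT.start hT, hCT'.start hT]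
    · rintro x ⟨hxeq, hx⟩ y hy
      have hxT : x ∈ Set.Icc 0 T := ⟨hx.1, hx.2.le⟩
      have hreq : rtot (fun j => ζ' j x) = rtot (fun j => ζ j x) := by
        congr 1
        exact funext hxeq
      rcases (hCT.rtot_nonneg hxT).eq_or_lt with hr | hr
      · refine ⟨min y T, fun k => ?_, lt_min hy hx.2, min_le_left _ _⟩
        have hm : min y T ∈ Set.Icc x T := ⟨le_min (le_of_lt hy) hx.2.le, min_le_right _ _⟩
        rw [h.eq_zero_of_rtot_eq_zero hCT hp hμ hxT hr.symm k _ hm,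
          h'.eq_zero_of_rtot_eq_zero hCT' hp hμ hxT (hreq.trans hr.symm) k _ hm]
      · have hev : ∀ᶠ v in 𝓝[Set.Icc 0 T] x,
            0 < rtot (fun j => ζ j v) ∧ 0 < rtot (fun j => ζ' j v) ∧
            (1 - ε) * rtot (fun j => ζ' j v) < rtot (fun j => ζ j v) ∧
            rtot (fun j => ζ j v) < (1 + ε) * rtot (fun j => ζ' j v) := by
          have c1 := hCT.continuousOn_rtot hμ x hxT
          have c2 := hCT'.continuousOn_rtot hμ x hxT
          refine (continuousWithinAt_const.eventually_lt c1 hr).and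
            ((continuousWithinAt_const.eventually_lt c2
              (hreq.symm ▸ hr : 0 < rtot fun j => ζ' j x)).and
            (((continuousWithinAt_const.mul c2).eventually_lt c1 ?_).and
            (c1.eventually_lt (continuousWithinAt_const.mul c2) ?_)))
          · change (1 - ε) * rtot (fun j => ζ' j x) < rtot fun j => ζ j x
            rw [hreq]
            nlinarith
          · change rtot (fun j => ζ j x) < (1 + ε) * rtot fun j => ζ' j x
            rw [hreq]
            nlinarith
        have hev' : ∀ᶠ v in 𝓝[≥] x, v ∈ Set.Icc x (min y T) ∧
            0 < rtot (fun j => ζ j v) ∧ 0 < rtot (fun j => ζ' j v) ∧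
            (1 - ε) * rtot (fun j => ζ' j v) < rtot (fun j => ζ j v) ∧
            rtot (fun j => ζ j v) < (1 + ε) * rtot (fun j => ζ' j v) := by
          refine Filter.Eventually.and (Icc_mem_nhdsGE (lt_min hy hx.2)) ?_
          have hle : 𝓝[≥] x ≤ 𝓝[Set.Icc 0 T] x := by
            rw [← nhdsWithin_Icc_eq_nhdsGE hx.2]
            exact nhdsWithin_mono _ (Set.Icc_subset_Icc_left hx.1)
          exact hle hev
        obtain ⟨u, hxu, hu⟩ := mem_nhdsGE_iff_exists_Icc_subset.1 hev'
        have hum := (hu ⟨hxu.le, le_rfl⟩).1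
        refine ⟨u, fun k => ?_, hxu, hum.2.trans (min_le_left _ _)⟩
        refine hgap.eqOn_Icc hε1 h h' hCT hCT' hp hμ hx.1
          (hum.2.trans (min_le_right _ _)) hxeq (fun v hv => ?_) k u ⟨hxu.le, le_rfl⟩
        obtain ⟨-, h1, h2, h3, h4⟩ := hu hv
        exact ⟨h1, h2, h3.le, h4.le⟩
  refine ⟨fun k t ht => hζ ht k, fun t ht => ?_⟩
  have hcons : ∀ v ∈ Set.Icc 0 T, ∀ y, consumed ζ' φ 0 (v, y) = consumed ζ φ 0 (v, y) := by
    intro v hv y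
    simp only [consumed, show (fun j => ζ' j v) = fun j => ζ j v from funext (hζ hv)]
  have hB : Bint ζ' φ 0 t = Bint ζ φ 0 t := by
    rw [Bint_eq, Bint_eq]
    refine setIntegral_congr_fun (measurableSet_Icc.prod measurableSet_Icc) fun q hq => ?_
    exact hcons q.1 ⟨hq.1.1, hq.1.2.trans ht.2⟩ q.2
  have := h.drift_sub h' hCT hCT' hp hμ ht ht fun k _ => hζ ht k
  rw [hB] at this
  linarith

end Uniqueness
section Squeeze

/-- Compress the part of the control below the threshold `r` into `[0, (1 - ε) r)`, and leave a gap
in `[(1 - ε) r, (1 + ε) r)`. -/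
noncomputable def squeeze (ε : ℝ) (r : ℕ → ℝ → ℝ) (φ : ℕ → ℝ → ℝ → ℝ) (k : ℕ) (s y : ℝ) : ℝ :=
  if y < (1 - ε) * r k s then (1 - ε)⁻¹ * φ k s ((1 - ε)⁻¹ * y)
  else if y < (1 + ε) * r k s then 0 else φ k s y

/-- The thresholds of `ζ`, with time truncated to `[0, T]`. -/
noncomputable def threshold (T : ℝ) (ζ : ℕ → ℝ → ℝ) (k : ℕ) (s : ℝ) : ℝ :=
  rcoord (fun j => ζ j (max 0 (min T s))) k

theorem threshold_eq {T : ℝ} (ζ : ℕ → ℝ → ℝ) (k : ℕ) {s : ℝ} (hs : s ∈ Set.Icc 0 T) :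
    threshold T ζ k s = rcoord (fun j => ζ j s) k := by
  rw [threshold, min_eq_right hs.2, max_eq_right hs.1]

theorem map_prod_const_mul {c : ℝ} (hc : 0 < c) :
    Measure.map (fun q : ℝ × ℝ => (q.1, c⁻¹ * q.2)) volume = ENNReal.ofReal c • volume := by
  have h := Measure.map_prod_map (volume : Measure ℝ) (volume : Measure ℝ) measurable_id
    (measurable_const_mul c⁻¹)
  rw [Measure.map_id, Real.map_volume_mul_left (inv_ne_zero hc.ne'), inv_inv, abs_of_pos hc,
    Measure.prod_smul_right] at h
  exact h.symm

theorem measurableEmbedding_prod_const_mul {c : ℝ} (hc : 0 < c) :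
    MeasurableEmbedding fun q : ℝ × ℝ => (q.1, c⁻¹ * q.2) :=
  ((MeasurableEquiv.refl ℝ).prodCongr
    (MeasurableEquiv.mulLeft₀ c⁻¹ (inv_ne_zero hc.ne'))).measurableEmbedding

theorem integrable_prod_const_mul {c : ℝ} (hc : 0 < c) {F : ℝ × ℝ → ℝ} (hF : Integrable F) :
    Integrable fun q : ℝ × ℝ => F (q.1, c⁻¹ * q.2) := by
  refine ((measurableEmbedding_prod_const_mul hc).integrable_map_iff (g := F)).1 ?_
  rw [map_prod_const_mul hc]
  exact hF.smul_measure ENNReal.ofReal_ne_top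

theorem integral_prod_const_mul {c : ℝ} (hc : 0 < c) (F : ℝ × ℝ → ℝ) :
    ∫ q : ℝ × ℝ, F (q.1, c⁻¹ * q.2) = c * ∫ q, F q := by
  rw [← (measurableEmbedding_prod_const_mul hc).integral_map (μ := volume) (g := F),
    map_prod_const_mul hc, integral_smul_measure, ENNReal.toReal_ofReal hc.le, smul_eq_mul]

theorem lintegral_prod_const_mul {c : ℝ} (hc : 0 < c) (F : ℝ × ℝ → ℝ≥0∞) :
    ∫⁻ q : ℝ × ℝ, F (q.1, c⁻¹ * q.2) = ENNReal.ofReal c * ∫⁻ q, F q := by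
  rw [← (measurableEmbedding_prod_const_mul hc).lintegral_map (μ := volume) (f := F),
    map_prod_const_mul hc, lintegral_smul_measure, smul_eq_mul]

variable {T : ℝ} {p : ℕ → ℝ} {ζ : ℕ → ℝ → ℝ} {ψ : ℝ → ℝ} {φ : ℕ → ℝ → ℝ → ℝ} {ε : ℝ}

theorem memCT.measurable_threshold (h : memCT T p ζ ψ) (hT : 0 ≤ T)
    (hμ : Summable fun k : ℕ => (k : ℝ) * p k) (k : ℕ) : Measurable (threshold T ζ k) := by
  have hclamp : Continuous fun s : ℝ => max 0 (min T s) := by fun_prop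
  have hmem : ∀ s : ℝ, max 0 (min T s) ∈ Set.Icc 0 T := fun s =>
    ⟨le_max_left _ _, max_le hT (min_le_left _ _)⟩
  have hζ : ∀ k, Measurable fun s => ζ k (max 0 (min T s)) := fun k =>
    ((h.1 k).comp_continuous hclamp hmem).measurable
  have hr : Measurable fun s => rtot fun j => ζ j (max 0 (min T s)) :=
    ((h.continuousOn_rtot hμ).comp_continuous hclamp hmem).measurable
  unfold threshold rcoord
  refine Measurable.ite (measurableSet_lt measurable_const hr) (Measurable.div ?_ hr)
    measurable_const
  rcases eq_or_ne k 0 with rfl | hk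
  · simpa using (hζ 0).max measurable_const
  · simpa [hk] using (hζ k).const_mul (k : ℝ)

theorem measurable_squeeze {r : ℕ → ℝ → ℝ} {k : ℕ} (hr : Measurable (r k))
    (hφ : Measurable fun q : ℝ × ℝ => φ k q.1 q.2) :
    Measurable fun q : ℝ × ℝ => squeeze ε r φ k q.1 q.2 := by
  unfold squeeze
  have hr' : Measurable fun q : ℝ × ℝ => r k q.1 := hr.comp measurable_fst
  have hφ' : Measurable fun q : ℝ × ℝ => φ k q.1 ((1 - ε)⁻¹ * q.2) :=
    hφ.comp (measurable_fst.prodMk (measurable_snd.const_mul _))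
  exact Measurable.ite (measurableSet_lt measurable_snd (hr'.const_mul _)) (hφ'.const_mul _)
    (Measurable.ite (measurableSet_lt measurable_snd (hr'.const_mul _)) measurable_const hφ)

theorem hasGap_squeeze (T ε : ℝ) (ζ : ℕ → ℝ → ℝ) (φ : ℕ → ℝ → ℝ → ℝ) :
    HasGap T ε ζ (squeeze ε (threshold T ζ) φ) := by
  intro k s hs y h1 h2
  rw [squeeze, threshold_eq ζ k hs, if_neg (not_lt.2 h1), if_pos h2]

/-- Squeezing acts on the consumed part of the control as a change of variables. -/
theorem memCT.indicator_consumed_squeeze (h : memCT T p ζ ψ)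
    (hμ : Summable fun k : ℕ => (k : ℝ) * p k) (hε : 0 ≤ ε) (hε1 : ε < 1) (k : ℕ) {t : ℝ}
    (ht : t ≤ T) (q : ℝ × ℝ) :
    (Set.Icc 0 t ×ˢ Set.Icc 0 1).indicator
        (consumed ζ (squeeze ε (threshold T ζ) φ) k) q =
      (1 - ε)⁻¹ * (Set.Icc 0 t ×ˢ Set.Icc 0 1).indicator (consumed ζ φ k)
        (q.1, (1 - ε)⁻¹ * q.2) := by
  obtain ⟨s, y⟩ := q
  have hc : 0 < 1 - ε := by linarith
  by_cases hs : s ∈ Set.Icc 0 t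
  swap
  · have hn : ∀ z : ℝ, (s, z) ∉ Set.Icc 0 t ×ˢ Set.Icc (0 : ℝ) 1 := fun z hq => hs hq.1
    rw [Set.indicator_of_notMem (hn _), Set.indicator_of_notMem (hn _), mul_zero]
  have hsT : s ∈ Set.Icc 0 T := ⟨hs.1, hs.2.trans ht⟩
  have hr0 := h.rcoord_nonneg hsT k
  have hr1 := h.rcoord_le_one hμ hsT k
  set r := rcoord (fun j => ζ j s) k with hr
  have hiff : (1 - ε)⁻¹ * y < r ↔ y < (1 - ε) * r := inv_mul_lt_iff₀ hc
  have hnn : 0 ≤ (1 - ε)⁻¹ * y ↔ 0 ≤ y := mul_nonneg_iff_of_pos_left (inv_pos.2 hc)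
  by_cases hy : 0 ≤ y ∧ y < (1 - ε) * r
  · have hyr : y < r := by nlinarith
    have hy' := hiff.2 hy.2
    have hm : ∀ z : ℝ, 0 ≤ z → z ≤ 1 → (s, z) ∈ Set.Icc 0 t ×ˢ Set.Icc (0 : ℝ) 1 :=
      fun z h0 h1 => ⟨hs, h0, h1⟩
    rw [Set.indicator_of_mem (hm _ hy.1 (hyr.trans_le hr1).le),
      Set.indicator_of_mem (hm _ (hnn.2 hy.1) (hy'.trans_le hr1).le)]
    simp only [consumed, ← hr]
    rw [if_pos ⟨hy.1, hyr⟩, if_pos ⟨hnn.2 hy.1, hy'⟩, squeeze, threshold_eq ζ k hsT, ← hr,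
      if_pos hy.2]
  · have hR : consumed ζ φ k (s, (1 - ε)⁻¹ * y) = 0 := by
      simp only [consumed, ← hr]
      rw [if_neg]
      rwa [hiff, hnn]
    have hL : consumed ζ (squeeze ε (threshold T ζ) φ) k (s, y) = 0 := by
      simp only [consumed, ← hr]
      split_ifs with hyr
      · rw [squeeze, threshold_eq ζ k hsT, ← hr, if_neg fun h1 => hy ⟨hyr.1, h1⟩, if_pos]
        nlinarith [hyr.2]
      · rfl
    rw [Set.indicator_apply_eq_zero.2 fun _ => hL, Set.indicator_apply_eq_zero.2 fun _ => hR,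
      mul_zero]

theorem memST.squeeze (h : memST T p ζ ψ φ) (hCT : memCT T p ζ ψ) (hT : 0 ≤ T)
    (hμ : Summable fun k : ℕ => (k : ℝ) * p k) (hε : 0 ≤ ε) (hε1 : ε < 1) :
    memST T p ζ ψ (squeeze ε (threshold T ζ) φ) := by
  have hc : 0 < 1 - ε := by linarith
  have hmeas : ∀ t : ℝ, MeasurableSet (Set.Icc 0 t ×ˢ Set.Icc (0 : ℝ) 1) := fun t =>
    measurableSet_Icc.prod measurableSet_Icc
  have hB : ∀ t ≤ T, ∀ k, Bint ζ (_root_.squeeze ε (threshold T ζ) φ) k t = Bint ζ φ k t := by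
    intro t ht k
    rw [Bint_eq, Bint_eq, ← integral_indicator (hmeas t), ← integral_indicator (hmeas t)]
    simp_rw [hCT.indicator_consumed_squeeze hμ hε hε1 k ht]
    rw [integral_const_mul, integral_prod_const_mul hc
      ((Set.Icc 0 t ×ˢ Set.Icc 0 1).indicator (consumed ζ φ k)), ← mul_assoc,
      inv_mul_cancel₀ hc.ne', one_mul]
  refine ⟨fun k => measurable_squeeze (hCT.measurable_threshold hT hμ k) (h.1 k), fun k s y => ?_,
    fun k => ?_, fun t ht => ?_, fun t ht k hk => ?_⟩
  · unfold _root_.squeeze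
    have := h.2.1
    split_ifs
    exacts [mul_nonneg (inv_nonneg.2 hc.le) (this _ _ _), le_rfl, this _ _ _]
  · change IntegrableOn (consumed ζ (_root_.squeeze ε (threshold T ζ) φ) k) _
    rw [← integrable_indicator_iff (hmeas T)]
    simp_rw [funext (hCT.indicator_consumed_squeeze hμ hε hε1 k le_rfl)]
    exact (integrable_prod_const_mul hc
      ((integrable_indicator_iff (hmeas T)).2 (h.integrableOn k))).const_mul _
  · simp_rw [hB t ht.2]
    exact h.2.2.2.1 t ht
  · rw [hB t ht.2]
    exact h.2.2.2.2 t ht k hk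

end Squeeze
section Cost

variable {T : ℝ} {p : ℕ → ℝ} {ζ : ℕ → ℝ → ℝ} {ψ : ℝ → ℝ} {φ : ℕ → ℝ → ℝ → ℝ} {ε : ℝ}

theorem measurable_ell : Measurable ell := by
  unfold ell
  fun_prop

theorem mul_ell_inv_mul_le {c x : ℝ} (hc : 0 < c) (hc1 : c ≤ 1) (hx : 0 ≤ x) :
    c * ell (c⁻¹ * x) ≤ ell x + -Real.log c * x := by
  rcases hx.eq_or_lt with rfl | hx
  · simpa [ell] using hc1
  · unfold ell
    rw [Real.log_mul (inv_ne_zero hc.ne') hx.ne', Real.log_inv]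
    have : c * (c⁻¹ * x * (-Real.log c + Real.log x) - c⁻¹ * x + 1) =
        x * (-Real.log c + Real.log x) - x + c := by
      field_simp
    rw [this]
    linarith

theorem lintegral_window {T : ℝ} {ε : ℝ} (hε : 0 ≤ ε) {r : ℝ → ℝ} (hr : Measurable r) :
    ∫⁻ q, ({q : ℝ × ℝ | q.1 ∈ Set.Icc 0 T ∧ q.2 ∈ Set.Ico ((1 - ε) * r q.1)
        ((1 + ε) * r q.1)}.indicator 1 q : ℝ≥0∞) =
      ENNReal.ofReal (2 * ε) * ∫⁻ s in Set.Icc 0 T, ENNReal.ofReal (r s) := by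
  have hr' : Measurable fun q : ℝ × ℝ => r q.1 := hr.comp measurable_fst
  have hW : MeasurableSet {q : ℝ × ℝ | q.1 ∈ Set.Icc 0 T ∧ q.2 ∈ Set.Ico ((1 - ε) * r q.1)
      ((1 + ε) * r q.1)} :=
    (measurable_fst measurableSet_Icc).inter
      ((measurableSet_le (hr'.const_mul _) measurable_snd).inter
        (measurableSet_lt measurable_snd (hr'.const_mul _)))
  rw [lintegral_indicator_one hW, Measure.volume_eq_prod, Measure.prod_apply hW,
    ← lintegral_const_mul _ hr.ennreal_ofReal, ← lintegral_indicator measurableSet_Icc]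
  refine lintegral_congr fun s => ?_
  by_cases hs : s ∈ Set.Icc 0 T
  · rw [Set.indicator_of_mem hs, ← ENNReal.ofReal_mul (by linarith)]
    have : Prod.mk s ⁻¹' {q : ℝ × ℝ | q.1 ∈ Set.Icc 0 T ∧ q.2 ∈ Set.Ico ((1 - ε) * r q.1)
        ((1 + ε) * r q.1)} = Set.Ico ((1 - ε) * r s) ((1 + ε) * r s) := by
      ext y
      exact ⟨fun h => h.2, fun h => ⟨hs, h⟩⟩
    rw [this, Real.volume_Ico]
    congr 1
    ring
  · rw [Set.indicator_of_notMem hs]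
    convert measure_empty (μ := (volume : Measure ℝ))
    ext y
    exact ⟨fun h => hs h.1, fun h => h.elim⟩

theorem lintegral_ell_squeeze_le (h : memST T p ζ ψ φ) (hCT : memCT T p ζ ψ) (hT : 0 ≤ T)
    (hμ : Summable fun k : ℕ => (k : ℝ) * p k) (hε : 0 ≤ ε) (hε1 : ε < 1) (k : ℕ) :
    ∫⁻ q in Set.Icc (0 : ℝ) T ×ˢ Set.Icc (0 : ℝ) 1,
        ENNReal.ofReal (ell (squeeze ε (threshold T ζ) φ k q.1 q.2)) ≤
      (∫⁻ q in Set.Icc (0 : ℝ) T ×ˢ Set.Icc (0 : ℝ) 1, ENNReal.ofReal (ell (φ k q.1 q.2))) +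
        ENNReal.ofReal (-Real.log (1 - ε)) * ENNReal.ofReal (Bint ζ φ k T) +
        ENNReal.ofReal (2 * ε) * ∫⁻ s in Set.Icc 0 T, ENNReal.ofReal (threshold T ζ k s) := by
  have hc : 0 < 1 - ε := by linarith
  have hL : 0 ≤ -Real.log (1 - ε) :=
    neg_nonneg.2 (Real.log_nonpos hc.le (by linarith))
  have hrm := hCT.measurable_threshold hT hμ k
  have hrm' : Measurable fun q : ℝ × ℝ => threshold T ζ k q.1 := hrm.comp measurable_fst
  have hφm : Measurable fun q : ℝ × ℝ => φ k q.1 q.2 := h.1 k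
  set D := Set.Icc (0 : ℝ) T ×ˢ Set.Icc (0 : ℝ) 1
  have hDm : MeasurableSet D := measurableSet_Icc.prod measurableSet_Icc
  have hem : Measurable fun q : ℝ × ℝ => ENNReal.ofReal (ell (φ k q.1 q.2)) :=
    (measurable_ell.comp hφm).ennreal_ofReal
  have hlt : MeasurableSet {q : ℝ × ℝ | q.2 < threshold T ζ k q.1} :=
    measurableSet_lt measurable_snd hrm'
  set G : ℝ × ℝ → ℝ≥0∞ := D.indicator fun q => if q.2 < threshold T ζ k q.1 then
    ENNReal.ofReal (ell ((1 - ε)⁻¹ * φ k q.1 q.2)) else 0 with hG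
  set H : ℝ × ℝ → ℝ≥0∞ := D.indicator fun q => if q.2 < threshold T ζ k q.1 then 0 else
    ENNReal.ofReal (ell (φ k q.1 q.2)) with hH
  set W : ℝ × ℝ → ℝ≥0∞ := {q : ℝ × ℝ | q.1 ∈ Set.Icc 0 T ∧ q.2 ∈ Set.Ico
    ((1 - ε) * threshold T ζ k q.1) ((1 + ε) * threshold T ζ k q.1)}.indicator 1 with hW
  have hGm : Measurable G := (Measurable.ite hlt
    (measurable_ell.comp (hφm.const_mul _)).ennreal_ofReal measurable_const).indicator hDm
  have hHm : Measurable H := (Measurable.ite hlt measurable_const hem).indicator hDm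
  have hGcm : Measurable fun q : ℝ × ℝ => G (q.1, (1 - ε)⁻¹ * q.2) :=
    hGm.comp (measurable_fst.prodMk (measurable_snd.const_mul _))
  have hpt : ∀ q, D.indicator (fun q => ENNReal.ofReal
      (ell (squeeze ε (threshold T ζ) φ k q.1 q.2))) q ≤ G (q.1, (1 - ε)⁻¹ * q.2) + H q + W q := by
    rintro ⟨s, y⟩
    by_cases hq : (s, y) ∈ D
    swap
    · rw [Set.indicator_of_notMem hq]
      exact zero_le
    have hr0 : 0 ≤ threshold T ζ k s := threshold_eq ζ k hq.1 ▸ hCT.rcoord_nonneg hq.1 k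
    have hr1 : threshold T ζ k s ≤ 1 := threshold_eq ζ k hq.1 ▸ hCT.rcoord_le_one hμ hq.1 k
    rw [Set.indicator_of_mem hq]
    dsimp only
    unfold squeeze
    split_ifs with h1 h2
    · have hy' : (1 - ε)⁻¹ * y < threshold T ζ k s := (inv_mul_lt_iff₀ hc).2 h1
      have hmem : (s, (1 - ε)⁻¹ * y) ∈ D :=
        ⟨hq.1, mul_nonneg (inv_nonneg.2 hc.le) hq.2.1, (hy'.trans_le hr1).le⟩
      refine le_add_right (le_add_right ?_)
      rw [hG, Set.indicator_of_mem hmem, if_pos hy']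
    · refine le_add_left ?_
      have hmem : (s, y) ∈ {q : ℝ × ℝ | q.1 ∈ Set.Icc 0 T ∧ q.2 ∈ Set.Ico
          ((1 - ε) * threshold T ζ k q.1) ((1 + ε) * threshold T ζ k q.1)} :=
        ⟨hq.1, not_lt.1 h1, h2⟩
      rw [hW, Set.indicator_of_mem hmem]
      simp [ell]
    · refine le_add_right (le_add_left ?_)
      rw [hH, Set.indicator_of_mem hq, if_neg]
      dsimp only
      nlinarith
  have hpt' : ∀ q, ENNReal.ofReal (1 - ε) * G q + H q ≤
      D.indicator (fun q => ENNReal.ofReal (ell (φ k q.1 q.2))) q + ENNReal.ofReal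
        (-Real.log (1 - ε)) * D.indicator (fun q => ENNReal.ofReal (consumed ζ φ k q)) q := by
    rintro ⟨s, y⟩
    by_cases hq : (s, y) ∈ D
    swap
    · simp [hG, hH, Set.indicator_of_notMem hq]
    rw [hG, hH]
    simp only [Set.indicator_of_mem hq]
    split_ifs with h1
    · rw [consumed, if_pos ⟨hq.2.1, threshold_eq ζ k hq.1 ▸ h1⟩, ← ENNReal.ofReal_mul hc.le,
        ← ENNReal.ofReal_mul hL, add_zero]
      exact (ENNReal.ofReal_le_ofReal (mul_ell_inv_mul_le hc (by linarith) (h.2.1 k s y))).trans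
        ENNReal.ofReal_add_le
    · simp
  have hB : ENNReal.ofReal (Bint ζ φ k T) =
      ∫⁻ q, D.indicator (fun q => ENNReal.ofReal (consumed ζ φ k q)) q := by
    rw [Bint_eq, ofReal_integral_eq_lintegral_ofReal (h.integrableOn k)
      (Eventually.of_forall (consumed_nonneg h.2.1 k)), lintegral_indicator hDm]
  rw [hB, ← lintegral_window hε hrm, ← lintegral_indicator hDm, ← lintegral_indicator hDm,
    ← lintegral_const_mul' _ _ ENNReal.ofReal_ne_top, ← lintegral_add_left
      (hem.indicator hDm)]
  calc _ ≤ ∫⁻ q, (G (q.1, (1 - ε)⁻¹ * q.2) + H q + W q) := lintegral_mono hpt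
    _ = (∫⁻ q, (ENNReal.ofReal (1 - ε) * G q + H q)) + ∫⁻ q, W q := by
        rw [lintegral_add_left (f := fun q : ℝ × ℝ => G (q.1, (1 - ε)⁻¹ * q.2) + H q)
          (hGcm.add hHm), lintegral_add_left hGcm,
          lintegral_prod_const_mul hc G, lintegral_add_left (hGm.const_mul _),
          lintegral_const_mul _ hGm]
    _ ≤ _ := by
        exact add_le_add_left (lintegral_mono hpt') _

/-- The cost of squeezing is linear in the width of the gap. -/
theorem costE_squeeze_le (h : memST T p ζ ψ φ) (hCT : memCT T p ζ ψ) (hT : 0 ≤ T)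
    (hμ : Summable fun k : ℕ => (k : ℝ) * p k) (hε : 0 ≤ ε) (hε1 : ε ≤ 1 / 2) :
    costE T (squeeze ε (threshold T ζ) φ) ≤
      costE T φ + ENNReal.ofReal (2 * ε) *
        (∑' k, ENNReal.ofReal (Bint ζ φ k T) + ENNReal.ofReal T) := by
  have hlog : -Real.log (1 - ε) ≤ 2 * ε := by
    have hc : 0 < 1 - ε := by linarith
    have h1 := Real.one_sub_inv_le_log_of_pos hc
    have h2 : (1 - ε)⁻¹ ≤ 1 + 2 * ε := by
      rw [inv_le_iff_one_le_mul₀ hc]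
      nlinarith
    linarith
  have hthr : ∑' k, ∫⁻ s in Set.Icc 0 T, ENNReal.ofReal (threshold T ζ k s) ≤
      ENNReal.ofReal T := by
    rw [← lintegral_tsum fun k => (hCT.measurable_threshold hT hμ k).ennreal_ofReal.aemeasurable]
    calc _ ≤ ∫⁻ _ in Set.Icc 0 T, (1 : ℝ≥0∞) := by
          refine setLIntegral_mono measurable_const fun s hs => ?_
          simp_rw [threshold_eq ζ _ hs]
          exact hCT.tsum_rcoord_le hμ hs
      _ = ENNReal.ofReal T := by simp
  unfold costE
  calc _ ≤ ∑' k, ((∫⁻ q in Set.Icc (0 : ℝ) T ×ˢ Set.Icc (0 : ℝ) 1,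
          ENNReal.ofReal (ell (φ k q.1 q.2))) +
        ENNReal.ofReal (2 * ε) * ENNReal.ofReal (Bint ζ φ k T) +
        ENNReal.ofReal (2 * ε) * ∫⁻ s in Set.Icc 0 T, ENNReal.ofReal (threshold T ζ k s)) := by
        refine ENNReal.tsum_le_tsum fun k => ?_
        refine (lintegral_ell_squeeze_le h hCT hT hμ hε (by linarith) k).trans ?_
        gcongr
    _ ≤ _ := by
        rw [ENNReal.tsum_add, ENNReal.tsum_add, ENNReal.tsum_mul_left, ENNReal.tsum_mul_left,
          mul_add, add_assoc]
        gcongr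

theorem memST.tsum_Bint_ne_top (h : memST T p ζ ψ φ) (hCT : memCT T p ζ ψ) (hT : 0 ≤ T)
    (hp : Summable p) : ∑' k, ENNReal.ofReal (Bint ζ φ k T) ≠ ⊤ := by
  refine Summable.tsum_ofReal_ne_top ((summable_nat_add_iff 1).1 ?_)
  have hTm : T ∈ Set.Icc 0 T := ⟨hT, le_rfl⟩
  refine ((summable_nat_add_iff 1).2 hp).of_nonneg_of_le (fun k => ?_) fun k => ?_
  · exact integral_nonneg fun q => consumed_nonneg h.2.1 _ q
  · linarith [h.2.2.2.2 T hTm (k + 1) k.succ_pos, hCT.coord_nonneg hTm (k + 1)]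

end Cost

/-- Key uniqueness lemma: for `(ζ, ψ) ∈ C_T` with finite rate, there is a
`σ`-optimal control `φ* ∈ S_T(ζ, ψ)` that determines `(ζ, ψ)` uniquely among
pairs in `C_T`. -/
theorem sigma_optimal_unique_control (T : ℝ) (hT : 0 < T)
    (p : ℕ → ℝ) (hp0 : p 0 = 0) (hpnn : ∀ k, 0 ≤ p k) (hp1 : ∑' k : ℕ, p k = 1)
    (hμsum : Summable fun k : ℕ => (k : ℝ) * p k)
    (σ : ℝ) (hσ : σ ∈ Set.Ioo (0 : ℝ) 1)
    (ζ : ℕ → ℝ → ℝ) (ψ : ℝ → ℝ)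
    (hCT : memCT T p ζ ψ) (hfin : rateI T p ζ ψ < ⊤) :
    ∃ φs : ℕ → ℝ → ℝ → ℝ,
      memST T p ζ ψ φs ∧
      costE T φs ≤ rateI T p ζ ψ + ENNReal.ofReal σ ∧
      ∀ (ζ' : ℕ → ℝ → ℝ) (ψ' : ℝ → ℝ), memCT T p ζ' ψ' → memST T p ζ' ψ' φs →
        (∀ k : ℕ, ∀ t ∈ Set.Icc (0 : ℝ) T, ζ' k t = ζ k t) ∧
        (∀ t ∈ Set.Icc (0 : ℝ) T, ψ' t = ψ t) := by
  have hp : Summable p := by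
    by_contra hns
    rw [tsum_eq_zero_of_not_summable hns] at hp1
    exact zero_ne_one hp1
  have hσ2 : 0 < σ / 2 := half_pos hσ.1
  have hI : rateI T p ζ ψ = ⨅ (φ : ℕ → ℝ → ℝ → ℝ) (_ : memST T p ζ ψ φ), costE T φ := if_pos hCT
  have hlt : rateI T p ζ ψ < rateI T p ζ ψ + ENNReal.ofReal (σ / 2) :=
    ENNReal.lt_add_right hfin.ne (ENNReal.ofReal_pos.2 hσ2).ne'
  conv_lhs at hlt => rw [hI]
  simp only [iInf_lt_iff] at hlt
  obtain ⟨φ, hφ, hcost⟩ := hlt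
  obtain ⟨M, hM⟩ : ∃ M : ℝ≥0∞, M = ∑' k, ENNReal.ofReal (Bint ζ φ k T) + ENNReal.ofReal T :=
    ⟨_, rfl⟩
  have hMtop : M ≠ ⊤ := by
    rw [hM]
    exact ENNReal.add_ne_top.2 ⟨hφ.tsum_Bint_ne_top hCT hT.le hp, ENNReal.ofReal_ne_top⟩
  have hMnn : 0 ≤ M.toReal := ENNReal.toReal_nonneg
  obtain ⟨ε, hε0, hε1, hεM⟩ : ∃ ε : ℝ, 0 < ε ∧ ε ≤ 1 / 2 ∧ 2 * ε * M.toReal ≤ σ / 2 := by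
    refine ⟨min (1 / 2) (σ / (4 * (M.toReal + 1))), ?_, min_le_left _ _, ?_⟩
    · have := hσ.1
      positivity
    · have h1 := min_le_right (1 / 2) (σ / (4 * (M.toReal + 1)))
      rw [le_div_iff₀ (by positivity)] at h1
      have h2 : 0 ≤ min (1 / 2) (σ / (4 * (M.toReal + 1))) := by
        have := hσ.1
        positivity
      linarith
  have hψ := hφ.squeeze hCT hT.le hμsum hε0.le (show ε < 1 by linarith)
  refine ⟨squeeze ε (threshold T ζ) φ, hψ, ?_, fun ζ' ψ' hCT' hST' => ?_⟩
  · have hextra : ENNReal.ofReal (2 * ε) * M ≤ ENNReal.ofReal (σ / 2) := by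
      rw [← ENNReal.ofReal_toReal hMtop, ← ENNReal.ofReal_mul (by linarith)]
      exact ENNReal.ofReal_le_ofReal hεM
    calc _ ≤ costE T φ + ENNReal.ofReal (2 * ε) * M :=
          hM ▸ costE_squeeze_le hφ hCT hT.le hμsum hε0.le hε1
      _ ≤ rateI T p ζ ψ + ENNReal.ofReal (σ / 2) + ENNReal.ofReal (σ / 2) :=
          add_le_add hcost.le hextra
      _ = rateI T p ζ ψ + ENNReal.ofReal σ := by
          rw [add_assoc, ← ENNReal.ofReal_add hσ2.le hσ2.le, add_halves]
  · exact (hasGap_squeeze T ε ζ φ).unique hε0 (by linarith) hT.le hψ hST' hCT hCT' hp hμsum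
end

section
/- Let N < ∞ and suppose for each n ∈ ℕ, (ζ^n, ψ^n) ∈ C_T and φ^n ∈ S_T(ζ^n, ψ^n) with ∑_{k≥0} ∫_{[0,T]×[0,1]} ℓ(φ^n_k(s,y)) ds dy ≤ N + 1 for every n. For k ≥ 0 define B^n_k(t) := ∫_{[0,t]×[0,1]} 1_{[0, r_k(ζ^n(s)))}(y)·φ^n_k(s,y) ds dy, η^n := ζ^n_0 − ψ^n, and let ν^n_k be the finite measure on [0,T]×[0,1] with density φ^n_k with respect to Lebesgue measure. Then the sequence {(ν^n, ζ^n, ψ^n, B^n, η^n)}_n has a convergent subsequence, where each ν^n_k is considered with the topology of weak convergence of finite measures and each of ζ^n, B^n (resp. ψ^n, η^n) is considered in C([0,T],ℝ^∞) (resp. C([0,T],ℝ)) with the uniform (product) topology. -/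
open MeasureTheory Filter Topology
open scoped ENNReal

/-- The finite measure `νⁿ_k` on `[0,T] × [0,1]` with density `φⁿ_k` with respect to
Lebesgue measure. -/
noncomputable def ctrlMeas (T : ℝ) (φ : ℕ → ℝ → ℝ → ℝ) (k : ℕ) : Measure (ℝ × ℝ) :=
  ((volume : Measure (ℝ × ℝ)).restrict
      ((Set.Icc (0 : ℝ) T) ×ˢ (Set.Icc (0 : ℝ) 1))).withDensity
    fun q => ENNReal.ofReal (φ k q.1 q.2)

lemma mul_le_exp_sub_one_add_ell {x : ℝ} (hx : 0 ≤ x) (c : ℝ) :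
    c * x ≤ Real.exp c - 1 + ell x := by
  unfold ell
  rcases hx.eq_or_lt with rfl | hx
  · have := Real.exp_pos c
    simp only [mul_zero, zero_mul]
    linarith
  · have h : x * (c - Real.log x + 1) ≤ Real.exp c := by
      calc x * (c - Real.log x + 1) ≤ x * Real.exp (c - Real.log x) := by
            gcongr
            exact Real.add_one_le_exp _
        _ = Real.exp c := by
            rw [Real.exp_sub, Real.exp_log hx]
            field_simp
    nlinarith

lemma lintegral_ell_le {T : ℝ} {φ : ℕ → ℝ → ℝ → ℝ} {M : ℝ}
    (hcost : costE T φ ≤ ENNReal.ofReal M) {A : Set (ℝ × ℝ)}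
    (hA : A ⊆ Set.Icc (0 : ℝ) T ×ˢ Set.Icc (0 : ℝ) 1) (k : ℕ) :
    ∫⁻ q in A, ENNReal.ofReal (ell (φ k q.1 q.2)) ≤ ENNReal.ofReal M :=
  (lintegral_mono_set hA).trans ((ENNReal.le_tsum k).trans hcost)

/-- The entropy bound gives uniform integrability of the controls. -/
lemma mul_setLIntegral_control_le {T : ℝ} {φ : ℕ → ℝ → ℝ → ℝ} {M : ℝ}
    (hcost : costE T φ ≤ ENNReal.ofReal M) {A : Set (ℝ × ℝ)}
    (hA : A ⊆ Set.Icc (0 : ℝ) T ×ˢ Set.Icc (0 : ℝ) 1) {k : ℕ}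
    (hpos : ∀ s y, 0 ≤ φ k s y) {c : ℝ} (hc : 0 ≤ c) :
    ENNReal.ofReal c * ∫⁻ q in A, ENNReal.ofReal (φ k q.1 q.2) ≤
      ENNReal.ofReal (Real.exp c) * volume A + ENNReal.ofReal M := by
  calc ENNReal.ofReal c * ∫⁻ q in A, ENNReal.ofReal (φ k q.1 q.2)
      = ∫⁻ q in A, ENNReal.ofReal c * ENNReal.ofReal (φ k q.1 q.2) :=
        (lintegral_const_mul' _ _ ENNReal.ofReal_ne_top).symm
    _ ≤ ∫⁻ q in A, (ENNReal.ofReal (Real.exp c) + ENNReal.ofReal (ell (φ k q.1 q.2))) := by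
        refine lintegral_mono fun q => ?_
        rw [← ENNReal.ofReal_mul hc]
        refine (ENNReal.ofReal_le_ofReal ?_).trans ENNReal.ofReal_add_le
        linarith [mul_le_exp_sub_one_add_ell (hpos q.1 q.2) c]
    _ = ENNReal.ofReal (Real.exp c) * volume A +
          ∫⁻ q in A, ENNReal.ofReal (ell (φ k q.1 q.2)) := by
        rw [lintegral_add_left measurable_const, setLIntegral_const]
    _ ≤ _ := by
        gcongr
        exact lintegral_ell_le hcost hA k

lemma volume_Icc_prod_Icc (a b : ℝ) :
    volume (Set.Icc a b ×ˢ Set.Icc (0 : ℝ) 1 : Set (ℝ × ℝ)) = ENNReal.ofReal (b - a) := by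
  rw [Measure.volume_eq_prod, Measure.prod_prod, Real.volume_Icc, Real.volume_Icc]
  simp

lemma ctrlMeas_univ_le {T : ℝ} (hT : 0 ≤ T) {φ : ℕ → ℝ → ℝ → ℝ} {M : ℝ} (hM : 0 ≤ M)
    (hcost : costE T φ ≤ ENNReal.ofReal M) {k : ℕ} (hpos : ∀ s y, 0 ≤ φ k s y) :
    ctrlMeas T φ k Set.univ ≤ ENNReal.ofReal (Real.exp 1 * T + M) := by
  have h := mul_setLIntegral_control_le hcost subset_rfl hpos zero_le_one
  rw [ENNReal.ofReal_one, one_mul, volume_Icc_prod_Icc, sub_zero,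
    ← ENNReal.ofReal_mul (Real.exp_pos 1).le, ← ENNReal.ofReal_add (by positivity) hM] at h
  rwa [ctrlMeas, withDensity_apply _ MeasurableSet.univ, Measure.restrict_univ]

lemma ctrlMeas_compl (T : ℝ) (φ : ℕ → ℝ → ℝ → ℝ) (k : ℕ) :
    ctrlMeas T φ k (Set.Icc (0 : ℝ) T ×ˢ Set.Icc (0 : ℝ) 1)ᶜ = 0 := by
  refine withDensity_absolutelyContinuous _ _ ?_
  rw [Measure.restrict_apply (measurableSet_Icc.prod measurableSet_Icc).compl,
    Set.compl_inter_self, measure_empty]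

lemma Bint_zero (ζ : ℕ → ℝ → ℝ) (φ : ℕ → ℝ → ℝ → ℝ) (k : ℕ) : Bint ζ φ k 0 = 0 :=
  setIntegral_measure_zero _ (by rw [volume_Icc_prod_Icc]; simp)

lemma Bint_increment {T : ℝ} {p : ℕ → ℝ} {ζ : ℕ → ℝ → ℝ} {ψ : ℝ → ℝ} {φ : ℕ → ℝ → ℝ → ℝ}
    {M : ℝ} (hM : 0 ≤ M) (hST : memST T p ζ ψ φ) (hcost : costE T φ ≤ ENNReal.ofReal M)
    (k : ℕ) {s t : ℝ} (hs : 0 ≤ s) (hst : s ≤ t) (ht : t ≤ T) :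
    Bint ζ φ k s ≤ Bint ζ φ k t ∧ ∀ c : ℝ, 0 ≤ c →
      c * (Bint ζ φ k t - Bint ζ φ k s) ≤ Real.exp c * (t - s) + M := by
  obtain ⟨-, hpos, hint, -, -⟩ := hST
  set g : ℝ × ℝ → ℝ := fun q =>
    if 0 ≤ q.2 ∧ q.2 < rcoord (fun j => ζ j q.1) k then φ k q.1 q.2 else 0 with hg
  have hg0 : ∀ q, 0 ≤ g q := fun q => by
    simp only [hg]; split_ifs; exacts [hpos _ _ _, le_rfl]
  have hgφ : ∀ q, g q ≤ φ k q.1 q.2 := fun q => by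
    simp only [hg]; split_ifs; exacts [le_rfl, hpos _ _ _]
  set S : Set (ℝ × ℝ) := Set.Icc (0 : ℝ) s ×ˢ Set.Icc (0 : ℝ) 1
  set D : Set (ℝ × ℝ) := Set.Ioc s t ×ˢ Set.Icc (0 : ℝ) 1
  have hDm : MeasurableSet D := measurableSet_Ioc.prod measurableSet_Icc
  have hunion : (Set.Icc (0 : ℝ) t ×ˢ Set.Icc (0 : ℝ) 1 : Set (ℝ × ℝ)) = S ∪ D := by
    rw [← Set.union_prod, Set.Icc_union_Ioc_eq_Icc hs hst]
  have hdisj : Disjoint S D := by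
    refine Set.disjoint_left.2 fun q hq hq' => ?_
    exact absurd hq.1.2 (not_le.2 hq'.1.1)
  have hDsub : D ⊆ Set.Icc (0 : ℝ) T ×ˢ Set.Icc (0 : ℝ) 1 :=
    Set.prod_mono (fun x hx => ⟨hs.trans hx.1.le, hx.2.trans ht⟩) subset_rfl
  have hSsub : S ⊆ Set.Icc (0 : ℝ) T ×ˢ Set.Icc (0 : ℝ) 1 :=
    Set.prod_mono (Set.Icc_subset_Icc_right (hst.trans ht)) subset_rfl
  have hdiff : Bint ζ φ k t = Bint ζ φ k s + ∫ q in D, g q := by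
    simp only [Bint]
    rw [hunion]
    exact setIntegral_union hdisj hDm ((hint k).mono_set hSsub) ((hint k).mono_set hDsub)
  have hD0 : 0 ≤ ∫ q in D, g q := integral_nonneg hg0
  refine ⟨by linarith, fun c hc => ?_⟩
  rw [hdiff, add_sub_cancel_left]
  have h1 := mul_setLIntegral_control_le hcost hDsub (hpos k) hc
  have hvol : volume D ≤ ENNReal.ofReal (t - s) := by
    rw [← volume_Icc_prod_Icc]
    exact measure_mono (Set.prod_mono Set.Ioc_subset_Icc_self subset_rfl)
  have h2 : ENNReal.ofReal (c * ∫ q in D, g q) ≤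
      ENNReal.ofReal (Real.exp c * (t - s) + M) := by
    rw [ENNReal.ofReal_mul hc, ENNReal.ofReal_add
      (mul_nonneg (Real.exp_pos c).le (sub_nonneg.2 hst)) hM,
      ENNReal.ofReal_mul (Real.exp_pos c).le,
      ofReal_integral_eq_lintegral_ofReal ((hint k).mono_set hDsub) (ae_of_all _ hg0)]
    calc ENNReal.ofReal c * ∫⁻ q in D, ENNReal.ofReal (g q)
        ≤ ENNReal.ofReal c * ∫⁻ q in D, ENNReal.ofReal (φ k q.1 q.2) := by
          gcongr with q
          exact hgφ q
      _ ≤ _ := h1.trans (by gcongr)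
  exact (ENNReal.ofReal_le_ofReal_iff
    (add_nonneg (mul_nonneg (Real.exp_pos c).le (sub_nonneg.2 hst)) hM)).1 h2

/-- A modulus of continuity for `Bint` that depends only on the cost bound. -/
lemma exists_uniform_modulus_Bint {M ε : ℝ} (hM : 0 ≤ M) (hε : 0 < ε) :
    ∃ δ > 0, ∀ {T : ℝ} {p : ℕ → ℝ} {ζ : ℕ → ℝ → ℝ} {ψ : ℝ → ℝ} {φ : ℕ → ℝ → ℝ → ℝ},
      memST T p ζ ψ φ → costE T φ ≤ ENNReal.ofReal M → ∀ k,
      ∀ s ∈ Set.Icc 0 T, ∀ t ∈ Set.Icc 0 T, |s - t| < δ →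
        |Bint ζ φ k s - Bint ζ φ k t| < ε := by
  set c := (M + 1) / ε
  have hc : 0 < c := by positivity
  have hcε : c * ε = M + 1 := div_mul_cancel₀ _ hε.ne'
  refine ⟨Real.exp (-c), Real.exp_pos _, ?_⟩
  intro T p ζ ψ φ hST hcost k
  have key : ∀ s ∈ Set.Icc 0 T, ∀ t ∈ Set.Icc 0 T, s ≤ t → |s - t| < Real.exp (-c) →
      |Bint ζ φ k s - Bint ζ φ k t| < ε := by
    intro s hs t ht hst hd
    obtain ⟨h1, h2⟩ := Bint_increment hM hST hcost k hs.1 hst ht.2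
    rw [abs_sub_comm, abs_of_nonneg (sub_nonneg.2 hst)] at hd
    rw [abs_sub_comm, abs_of_nonneg (sub_nonneg.2 h1)]
    have h3 : Real.exp c * (t - s) < 1 := by
      calc Real.exp c * (t - s) < Real.exp c * Real.exp (-c) := by gcongr
        _ = 1 := by rw [← Real.exp_add, add_neg_cancel, Real.exp_zero]
    refine lt_of_mul_lt_mul_left ?_ hc.le
    linarith [h2 c hc.le]
  intro s hs t ht hd
  rcases le_total s t with h | h
  · exact key s hs t ht h hd
  · rw [abs_sub_comm] at hd ⊢
    exact key t ht s hs h hd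

lemma abs_sInf_image_sub_le {α : Type*} {S : Set α} (hS : S.Nonempty) {f g : α → ℝ} {ε : ℝ}
    (hf : BddBelow (f '' S)) (hg : BddBelow (g '' S)) (h : ∀ x ∈ S, |f x - g x| ≤ ε) :
    |sInf (f '' S) - sInf (g '' S)| ≤ ε := by
  rw [abs_sub_le_iff]
  constructor
  · rw [sub_le_comm]
    refine le_csInf (hS.image g) ?_
    rintro _ ⟨x, hx, rfl⟩
    have := csInf_le hf ⟨x, hx, rfl⟩
    linarith [(abs_sub_le_iff.1 (h x hx)).1]
  · rw [sub_le_comm]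
    refine le_csInf (hS.image f) ?_
    rintro _ ⟨x, hx, rfl⟩
    have := csInf_le hg ⟨x, hx, rfl⟩
    linarith [(abs_sub_le_iff.1 (h x hx)).2]

/-- The regulator part of the Skorokhod map is continuous for uniform convergence. -/
lemma tendstoUniformlyOn_neg_min_sInf {T : ℝ} {f : ℕ → ℝ → ℝ} {g : ℝ → ℝ}
    (hf : ∀ n, ContinuousOn (f n) (Set.Icc 0 T)) (hg : ContinuousOn g (Set.Icc 0 T))
    (h : TendstoUniformlyOn f g atTop (Set.Icc 0 T)) :
    TendstoUniformlyOn (fun n t => -min (sInf (f n '' Set.Icc 0 t)) 0)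
      (fun t => -min (sInf (g '' Set.Icc 0 t)) 0) atTop (Set.Icc 0 T) := by
  rw [Metric.tendstoUniformlyOn_iff] at h ⊢
  intro ε hε
  filter_upwards [h (ε / 2) (by positivity)] with n hn t ht
  have hsub : Set.Icc 0 t ⊆ Set.Icc 0 T := Set.Icc_subset_Icc_right ht.2
  have hb : ∀ {u : ℝ → ℝ}, ContinuousOn u (Set.Icc 0 T) → BddBelow (u '' Set.Icc 0 t) :=
    fun hu => (isCompact_Icc.image_of_continuousOn (hu.mono hsub)).bddBelow
  have h1 := abs_sInf_image_sub_le (Set.nonempty_Icc.2 ht.1) (hb hg) (hb (hf n))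
    (fun x hx => (hn x (hsub hx)).le)
  rw [dist_neg_neg, Real.dist_eq]
  have h2 := abs_min_sub_min_le_max (sInf (g '' Set.Icc 0 t)) 0 (sInf (f n '' Set.Icc 0 t)) 0
  have h3 : max |sInf (g '' Set.Icc 0 t) - sInf (f n '' Set.Icc 0 t)| |(0 : ℝ) - 0| ≤ ε / 2 :=
    max_le h1 (by simp; positivity)
  exact (h2.trans h3).trans_lt (half_lt_self hε)

lemma exists_probabilityMeasure_smul_eq {E : Type*} [MeasurableSpace E] {K : Set E}
    (hK : MeasurableSet K) {x₀ : E} (hx₀ : x₀ ∈ K) (ν : Measure E) [IsFiniteMeasure ν]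
    (hν : ν Kᶜ = 0) :
    ∃ P : ProbabilityMeasure E, (P : Measure E) Kᶜ = 0 ∧
      ν = ν Set.univ • (P : Measure E) := by
  by_cases h : ν = 0
  · refine ⟨⟨Measure.dirac x₀, inferInstance⟩, ?_, by simp [h]⟩
    change Measure.dirac x₀ Kᶜ = 0
    rw [Measure.dirac_apply' _ hK.compl]
    simp [hx₀]
  · have : NeZero ν := ⟨h⟩
    refine ⟨⟨(ν Set.univ)⁻¹ • ν, inferInstance⟩, ?_, ?_⟩
    · change ((ν Set.univ)⁻¹ • ν) Kᶜ = 0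
      simp [hν]
    · change ν = ν Set.univ • (ν Set.univ)⁻¹ • ν
      rw [smul_smul, ENNReal.mul_inv_cancel (by simpa using h) (measure_ne_top _ _), one_smul]

/-- A sequence of families of measures with uniformly bounded mass, all carried by a fixed
compact set, together with a sequence of families of functions lying in compact sets, has a
jointly convergent subsequence. -/
lemma exists_subseq_tendsto_measure_and_function {E F : Type*} [TopologicalSpace E] [T2Space E]
    [TopologicalSpace.PseudoMetrizableSpace E] [TopologicalSpace.SeparableSpace E]
    [MeasurableSpace E] [BorelSpace E] [TopologicalSpace F] [FirstCountableTopology F]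
    {K : Set E} (hK : IsCompact K) (hK₀ : K.Nonempty) {C : ℝ} (hC : 0 ≤ C)
    (ν : ℕ → ℕ → Measure E) (hmass : ∀ n k, ν n k Set.univ ≤ ENNReal.ofReal C)
    (hsupp : ∀ n k, ν n k Kᶜ = 0) {A : ℕ → Set F} (hA : ∀ k, IsCompact (A k))
    (b : ℕ → ℕ → F) (hb : ∀ n k, b n k ∈ A k) :
    ∃ s : ℕ → ℕ, StrictMono s ∧
      (∃ νlim : ℕ → Measure E, (∀ k, IsFiniteMeasure (νlim k)) ∧
        ∀ k, ∀ f : BoundedContinuousFunction E ℝ,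
          Tendsto (fun n => ∫ q, f q ∂(ν (s n) k)) atTop (𝓝 (∫ q, f q ∂(νlim k)))) ∧
      ∃ l : ℕ → F, ∀ k, Tendsto (fun n => b (s n) k) atTop (𝓝 (l k)) := by
  obtain ⟨x₀, hx₀⟩ := hK₀
  have hfin : ∀ n k, IsFiniteMeasure (ν n k) := fun n k =>
    ⟨(hmass n k).trans_lt ENNReal.ofReal_lt_top⟩
  choose P hP hνP using fun n k =>
    exists_probabilityMeasure_smul_eq hK.measurableSet hx₀ (ν n k) (hsupp n k)
  set S : Set (ProbabilityMeasure E) := {Q | (Q : Measure E) Kᶜ = 0}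
  have hScomp : IsCompact (closure S) := by
    refine isCompact_closure_of_isTightMeasureSet ?_
    rw [isTightMeasureSet_iff_exists_isCompact_measure_compl_le]
    rintro ε -
    refine ⟨K, hK, ?_⟩
    rintro _ ⟨Q, hQ, rfl⟩
    exact (le_of_eq hQ).trans zero_le
  have hcomp : IsCompact (Set.univ.pi fun k => Set.Icc 0 C ×ˢ (closure S ×ˢ A k)) :=
    isCompact_univ_pi fun k => isCompact_Icc.prod (hScomp.prod (hA k))
  obtain ⟨a, ha, s, hs, hlim⟩ := hcomp.tendsto_subseq
    (x := fun n k => ((ν n k Set.univ).toReal, P n k, b n k)) (fun n k _ =>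
      ⟨⟨ENNReal.toReal_nonneg, ENNReal.toReal_le_of_le_ofReal hC (hmass n k)⟩,
        subset_closure (hP n k), hb n k⟩)
  rw [tendsto_pi_nhds] at hlim
  refine ⟨s, hs, ⟨fun k => ENNReal.ofReal (a k).1 • ((a k).2.1 : Measure E),
    fun k => Measure.smul_finite _ ENNReal.ofReal_ne_top, fun k f => ?_⟩, fun k => (a k).2.2, fun k => ?_⟩
  · have hm : Tendsto (fun n => (ν (s n) k Set.univ).toReal) atTop (𝓝 (a k).1) :=
      (hlim k).fst_nhds
    have hQ : Tendsto (fun n => P (s n) k) atTop (𝓝 (a k).2.1) := (hlim k).snd_nhds.fst_nhds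
    rw [integral_smul_measure, ENNReal.toReal_ofReal (ha k trivial).1.1]
    have hν : ∀ n, ∫ q, f q ∂(ν (s n) k) =
        (ν (s n) k Set.univ).toReal • ∫ q, f q ∂(P (s n) k : Measure E) := fun n => by
      conv_lhs => rw [hνP (s n) k]
      exact integral_smul_measure _ _
    simp_rw [hν]
    exact hm.smul (ProbabilityMeasure.tendsto_iff_forall_integral_tendsto.1 hQ f)
  · exact (hlim k).snd_nhds.snd_nhds

/-- Pre-compactness: a sequence of controlled trajectories with uniformly bounded cost
has a subsequence along which the control measures converge weakly and
`ζⁿ, ψⁿ, Bⁿ, ηⁿ` converge uniformly on `[0,T]` (coordinatewise in `k`). -/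
theorem pre_compactness (T : ℝ) (hT : 0 < T)
    (p : ℕ → ℝ) (hp0 : p 0 = 0) (hpnn : ∀ k, 0 ≤ p k) (hp1 : ∑' k : ℕ, p k = 1)
    (hmom : ∃ ε : ℝ, 0 < ε ∧ Summable fun k : ℕ => p k * (k : ℝ) ^ ((1 : ℝ) + ε))
    (N : ℝ)
    (ζ : ℕ → ℕ → ℝ → ℝ) (ψ : ℕ → ℝ → ℝ) (φ : ℕ → ℕ → ℝ → ℝ → ℝ)
    (hCT : ∀ n, memCT T p (ζ n) (ψ n))
    (hST : ∀ n, memST T p (ζ n) (ψ n) (φ n))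
    (hcost : ∀ n, costE T (φ n) ≤ ENNReal.ofReal (N + 1)) :
    ∃ s : ℕ → ℕ, StrictMono s ∧
      ∃ νlim : ℕ → Measure (ℝ × ℝ), (∀ k, IsFiniteMeasure (νlim k)) ∧
      ∃ ζl : ℕ → ℝ → ℝ, ∃ ψl : ℝ → ℝ, ∃ Bl : ℕ → ℝ → ℝ, ∃ ηl : ℝ → ℝ,
        (∀ k, ∀ f : BoundedContinuousFunction (ℝ × ℝ) ℝ,
          Tendsto (fun n => ∫ q, f q ∂(ctrlMeas T (φ (s n)) k)) atTop
            (𝓝 (∫ q, f q ∂(νlim k)))) ∧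
        (∀ k, TendstoUniformlyOn (fun n => ζ (s n) k) (ζl k) atTop (Set.Icc 0 T)) ∧
        TendstoUniformlyOn (fun n => ψ (s n)) ψl atTop (Set.Icc 0 T) ∧
        (∀ k, TendstoUniformlyOn (fun n => Bint (ζ (s n)) (φ (s n)) k) (Bl k) atTop
          (Set.Icc 0 T)) ∧
        TendstoUniformlyOn (fun n t => ζ (s n) 0 t - ψ (s n) t) ηl atTop
          (Set.Icc 0 T) := by
  obtain ⟨ε, hε, hsum⟩ := hmom
  set M : ℝ := max (N + 1) 0
  have hM : 0 ≤ M := le_max_right _ _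
  have hcost' : ∀ n, costE T (φ n) ≤ ENNReal.ofReal M := fun n =>
    (hcost n).trans (ENNReal.ofReal_le_ofReal (le_max_left _ _))
  set C : ℝ := Real.exp 1 * T + M
  have hC : 0 ≤ C := by positivity
  have hB0 : ∀ n k, ∀ t ∈ Set.Icc 0 T, 0 ≤ Bint (ζ n) (φ n) k t := fun n k t ht => by
    have := (Bint_increment hM (hST n) (hcost' n) k le_rfl ht.1 ht.2).1
    rwa [Bint_zero] at this
  have hBC : ∀ n k, ∀ t ∈ Set.Icc 0 T, Bint (ζ n) (φ n) k t ≤ C := fun n k t ht => by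
    have := (Bint_increment hM (hST n) (hcost' n) k le_rfl ht.1 ht.2).2 1 zero_le_one
    rw [Bint_zero] at this
    have h2 : Real.exp 1 * (t - 0) ≤ Real.exp 1 * T := by
      gcongr
      linarith [ht.2]
    linarith
  have hBp : ∀ n k, 1 ≤ k → ∀ t ∈ Set.Icc 0 T, Bint (ζ n) (φ n) k t ≤ p k :=
    fun n k hk t ht => by
      have h1 := (hST n).2.2.2.2 t ht k hk
      have h2 := ((hCT n).2.2.2.2.2 k hk).2.1 t ht
      linarith
  have hcont : ∀ n k, Continuous fun t : Set.Icc 0 T => Bint (ζ n) (φ n) k t := by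
    intro n k
    rw [Metric.continuous_iff]
    intro x e he
    obtain ⟨δ, hδ, h⟩ := exists_uniform_modulus_Bint hM he
    exact ⟨δ, hδ, fun y hy => h (hST n) (hcost' n) k y y.2 x x.2 hy⟩
  set b : ℕ → ℕ → BoundedContinuousFunction (Set.Icc 0 T) ℝ := fun n k =>
    BoundedContinuousFunction.mkOfCompact ⟨_, hcont n k⟩
  have hbapp : ∀ n k (t : Set.Icc 0 T), b n k t = Bint (ζ n) (φ n) k t := fun _ _ _ => rfl
  have hcomp : ∀ k, IsCompact (closure (Set.range fun n => b n k)) := by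
    intro k
    refine BoundedContinuousFunction.arzela_ascoli (Set.Icc 0 C) isCompact_Icc _ ?_ ?_
    · rintro _ x ⟨n, rfl⟩
      exact ⟨hB0 n k x x.2, hBC n k x x.2⟩
    · intro x
      rw [Metric.equicontinuousAt_iff]
      intro e he
      obtain ⟨δ, hδ, h⟩ := exists_uniform_modulus_Bint hM he
      refine ⟨δ, hδ, ?_⟩
      rintro y hy ⟨_, n, rfl⟩
      rw [dist_comm] at hy
      exact h (hST n) (hcost' n) k x x.2 y y.2 hy
  obtain ⟨s, hs, ⟨νlim, hνfin, hνlim⟩, l, hl⟩ :=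
    exists_subseq_tendsto_measure_and_function (isCompact_Icc.prod isCompact_Icc)
      ⟨((0 : ℝ), (0 : ℝ)), ⟨le_rfl, hT.le⟩, ⟨le_rfl, zero_le_one⟩⟩ hC
      (fun n k => ctrlMeas T (φ n) k)
      (fun n k => ctrlMeas_univ_le hT.le hM (hcost' n) ((hST n).2.1 k))
      (fun n k => ctrlMeas_compl T (φ n) k) hcomp b (fun n k => subset_closure ⟨n, rfl⟩)
  have hunif : ∀ {u : ℕ → BoundedContinuousFunction (Set.Icc 0 T) ℝ}
      {v : BoundedContinuousFunction (Set.Icc 0 T) ℝ} {f : ℕ → ℝ → ℝ},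
      (∀ n (t : Set.Icc 0 T), u n t = f n t) → Tendsto u atTop (𝓝 v) →
      TendstoUniformlyOn f (Set.IccExtend hT.le v) atTop (Set.Icc 0 T) := by
    intro u v f huf huv
    rw [tendstoUniformlyOn_iff_tendstoUniformly_comp_coe]
    have h := BoundedContinuousFunction.tendsto_iff_tendstoUniformly.1 huv
    have e1 : (fun n => f n ∘ ((↑) : Set.Icc 0 T → ℝ)) = fun n => ⇑(u n) :=
      funext fun n => funext fun t => (huf n t).symm
    have e2 : Set.IccExtend hT.le v ∘ ((↑) : Set.Icc 0 T → ℝ) = v :=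
      funext fun t => Set.IccExtend_val hT.le v t
    rw [e2]
    exact e1 ▸ h
  set w : ℕ → ℝ := fun k => (k + 2) * p k + if k = 0 then 2 * C else 0 with hw
  have hkp : Summable fun k : ℕ => (k : ℝ) * p k := by
    refine hsum.of_nonneg_of_le (fun k => mul_nonneg k.cast_nonneg (hpnn k)) fun k => ?_
    rw [mul_comm]
    refine mul_le_mul_of_nonneg_left ?_ (hpnn k)
    rcases Nat.eq_zero_or_pos k with rfl | hk
    · simp [(by positivity : (1 : ℝ) + ε ≠ 0)]
    · exact Real.self_le_rpow_of_one_le (by exact_mod_cast hk) (by linarith)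
  have hpsum : Summable p := by
    by_contra h
    rw [tsum_eq_zero_of_not_summable h] at hp1
    exact zero_ne_one hp1
  have hwsum : Summable w := by
    refine Summable.add ?_ ((hasSum_ite_eq 0 (2 * C)).summable)
    simp_rw [add_mul]
    exact hkp.add (hpsum.mul_left 2)
  have hbound : ∀ n (k : ℕ), ‖((k : ℝ) - 2) • b n k‖ ≤ w k := by
    intro n k
    have hw0 : 0 ≤ w k := by
      have := hpnn k
      simp only [hw]
      positivity
    rw [BoundedContinuousFunction.norm_le hw0]
    intro t
    rw [BoundedContinuousFunction.smul_apply, hbapp, norm_smul, Real.norm_eq_abs,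
      Real.norm_eq_abs, abs_of_nonneg (hB0 n k t t.2)]
    rcases Nat.eq_zero_or_pos k with rfl | hk
    · have := hBC n 0 t t.2
      simp [hw, hp0]
      linarith
    · have h2 : |(k : ℝ) - 2| ≤ k + 2 := by
        rw [abs_le]
        constructor <;> linarith [(k.cast_nonneg : (0 : ℝ) ≤ k)]
      simp only [hw, hk.ne', if_false, add_zero]
      exact mul_le_mul h2 (hBp n k hk t t.2) (hB0 n k t t.2) (by positivity)
  set L : BoundedContinuousFunction (Set.Icc 0 T) ℝ := ∑' k : ℕ, ((k : ℝ) - 2) • l k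
  have hΨ : Tendsto (fun n => ∑' k : ℕ, ((k : ℝ) - 2) • b (s n) k) atTop (𝓝 L) :=
    tendsto_tsum_of_dominated_convergence hwsum (fun k => (hl k).const_smul _)
      (Eventually.of_forall fun n k => hbound (s n) k)
  have hψapp : ∀ n (t : Set.Icc 0 T),
      (∑' k : ℕ, ((k : ℝ) - 2) • b (s n) k) t = ψ (s n) t := by
    intro n t
    have hsm : Summable fun k : ℕ => ((k : ℝ) - 2) • b (s n) k :=
      Summable.of_norm_bounded hwsum fun k => hbound (s n) k
    rw [(hST (s n)).2.2.2.1 t t.2]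
    exact (BoundedContinuousFunction.evalCLM ℝ t).map_tsum hsm
  have hψlim := hunif hψapp hΨ
  have hBlim : ∀ k, TendstoUniformlyOn (fun n => Bint (ζ (s n)) (φ (s n)) k)
      (Set.IccExtend hT.le (l k)) atTop (Set.Icc 0 T) := fun k =>
    hunif (fun n t => hbapp (s n) k t) (hl k)
  have hηlim : TendstoUniformlyOn (fun n t => ζ (s n) 0 t - ψ (s n) t)
      (fun t => -min (sInf (Set.IccExtend hT.le L '' Set.Icc 0 t)) 0) atTop (Set.Icc 0 T) := by
    refine (tendstoUniformlyOn_neg_min_sInf (fun n => (hCT (s n)).2.1)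
      (L.continuous.Icc_extend').continuousOn hψlim).congr (Eventually.of_forall fun n t ht => ?_)
    change -min (sInf (ψ (s n) '' Set.Icc 0 t)) 0 = ζ (s n) 0 t - ψ (s n) t
    rw [(hCT (s n)).2.2.2.2.1 t ht, skorokhod]
    ring
  have hζlim : ∀ k, ∃ z : ℝ → ℝ,
      TendstoUniformlyOn (fun n => ζ (s n) k) z atTop (Set.Icc 0 T) := by
    intro k
    rcases Nat.eq_zero_or_pos k with rfl | hk
    · refine ⟨_, (hηlim.add hψlim).congr (Eventually.of_forall fun n t _ => ?_)⟩
      simp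
    · have hp : TendstoUniformlyOn (fun (_ : ℕ) (_ : ℝ) => p k) (fun _ => p k) atTop
          (Set.Icc 0 T) := by
        rw [Metric.tendstoUniformlyOn_iff]
        intro e he
        exact Eventually.of_forall fun _ _ _ => by rwa [dist_self]
      refine ⟨_, (hp.sub (hBlim k)).congr (Eventually.of_forall fun n t ht => ?_)⟩
      exact ((hST (s n)).2.2.2.2 t ht k hk).symm
  choose ζl hζl using hζlim
  exact ⟨s, hs, νlim, hνfin, ζl, _, _, _, hνlim, hζl, hψlim, hBlim, hηlim⟩
end
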